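/- For every nonnegative integer n, b̅₅(10n+1) = c₅(5n+1) and b̅₅(10n+3) = c₅(5n+2). -/

import Mathlib

open scoped BigOperators

/-- The q-Pochhammer infinite product `(a; q)_∞ = ∏_{k≥0} (1 - a q^k)`. -/
noncomputable def qpoch (a q : ℂ) : ℂ := ∏' k : ℕ, (1 - a * q ^ k)

/-- `φ(-q) = (q;q)_∞² / (q²;q²)_∞`. -/
noncomputable def phiNeg (q : ℂ) : ℂ := qpoch q q ^ 2 / qpoch (q ^ 2) (q ^ 2)

/-- `ψ(-q) = (q;q)_∞ (q⁴;q⁴)_∞ / (q²;q²)_∞`. -/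
noncomputable def psiNeg (q : ℂ) : ℂ :=
  qpoch q q * qpoch (q ^ 4) (q ^ 4) / qpoch (q ^ 2) (q ^ 2)

open Filter Topology

/-- Finite q-Pochhammer symbol. -/
noncomputable def qfin (a q : ℂ) (n : ℕ) : ℂ := ∏ k ∈ Finset.range n, (1 - a * q ^ k)

lemma qp_summable (a : ℂ) {q : ℂ} (hq : ‖q‖ < 1) : Summable fun k : ℕ => ‖-(a * q ^ k)‖ := by
  simp only [norm_neg, norm_mul, norm_pow]
  exact (summable_geometric_of_lt_one (norm_nonneg q) hq).mul_left _

lemma qfin_tendsto (a : ℂ) {q : ℂ} (hq : ‖q‖ < 1) :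
    Tendsto (qfin a q) atTop (𝓝 (qpoch a q)) := by
  have h := (multipliable_one_add_of_summable (qp_summable a hq)).hasProd.tendsto_prod_nat
  have e : qfin a q = fun n => ∏ k ∈ Finset.range n, (1 - a * q ^ k) := rfl
  rw [e]
  simpa [qpoch, sub_eq_add_neg] using h

lemma qpoch_ne_zero {a q : ℂ} (hq : ‖q‖ < 1) (ha : ∀ k : ℕ, 1 - a * q ^ k ≠ 0) :
    qpoch a q ≠ 0 := by
  have := tprod_one_add_ne_zero_of_summable (f := fun k : ℕ => -(a * q ^ k))
    (by intro k; simpa [sub_eq_add_neg] using ha k) (qp_summable a hq)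
  simpa [qpoch, sub_eq_add_neg] using this

lemma one_sub_ne_zero_of_norm {x : ℂ} (h : ‖x‖ < 1) : 1 - x ≠ 0 := by
  intro h0
  have : x = 1 := by linear_combination -h0
  simp [this] at h

lemma norm_pow_lt_one {q : ℂ} (hq : ‖q‖ < 1) {n : ℕ} (hn : n ≠ 0) : ‖q ^ n‖ < 1 := by
  rw [norm_pow]; exact pow_lt_one₀ (norm_nonneg q) hq hn

lemma fin_factor_ne_zero {q : ℂ} (hq : ‖q‖ < 1) (k : ℕ) : 1 - q * q ^ k ≠ 0 := by
  apply one_sub_ne_zero_of_norm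
  rw [← pow_succ']
  exact norm_pow_lt_one hq (by omega)

lemma F_ne_zero {q : ℂ} (hq : ‖q‖ < 1) : qpoch q q ≠ 0 :=
  qpoch_ne_zero hq (fin_factor_ne_zero hq)

lemma qfin_ne_zero {q : ℂ} (hq : ‖q‖ < 1) (n : ℕ) : qfin q q n ≠ 0 :=
  Finset.prod_ne_zero_iff.2 fun k _ => fin_factor_ne_zero hq k

lemma qfin_split (a q : ℂ) (m n : ℕ) :
    qfin a q (m * n) = ∏ r ∈ Finset.range m, qfin (a * q ^ r) (q ^ m) n := by
  induction n with
  | zero => simp [qfin]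
  | succ n ih =>
    have : qfin a q (m * (n + 1)) =
        qfin a q (m * n) * ∏ r ∈ Finset.range m, (1 - a * q ^ (m * n + r)) := by
      unfold qfin
      rw [Nat.mul_succ, Finset.prod_range_add]
    rw [this, ih, ← Finset.prod_mul_distrib]
    refine Finset.prod_congr rfl fun r _ => ?_
    unfold qfin
    rw [Finset.prod_range_succ, ← pow_mul, pow_add]
    ring

lemma qpoch_split (a : ℂ) {q : ℂ} (hq : ‖q‖ < 1) {m : ℕ} (hm : m ≠ 0) :
    qpoch a q = ∏ r ∈ Finset.range m, qpoch (a * q ^ r) (q ^ m) := by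
  have h1 : Tendsto (fun n => qfin a q (m * n)) atTop (𝓝 (qpoch a q)) :=
    (qfin_tendsto a hq).comp (tendsto_id.const_mul_atTop' (Nat.pos_of_ne_zero hm))
  have h2 : Tendsto (fun n => ∏ r ∈ Finset.range m, qfin (a * q ^ r) (q ^ m) n) atTop
      (𝓝 (∏ r ∈ Finset.range m, qpoch (a * q ^ r) (q ^ m))) :=
    tendsto_finsetProd _ fun r _ => qfin_tendsto _ (norm_pow_lt_one hq hm)
  simp only [qfin_split] at h1
  exact tendsto_nhds_unique h1 h2

lemma qpoch_mul_neg (a : ℂ) {q : ℂ} (hq : ‖q‖ < 1) :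
    qpoch a q * qpoch (-a) q = qpoch (a ^ 2) (q ^ 2) := by
  have h1 := (qfin_tendsto a hq).mul (qfin_tendsto (-a) hq)
  refine tendsto_nhds_unique (h1.congr fun n => ?_)
    (qfin_tendsto (a ^ 2) (norm_pow_lt_one hq two_ne_zero))
  unfold qfin
  rw [← Finset.prod_mul_distrib]
  refine Finset.prod_congr rfl fun r _ => ?_
  ring

lemma qpoch_head (a : ℂ) {q : ℂ} (hq : ‖q‖ < 1) :
    qpoch a q = (1 - a) * qpoch (a * q) q := by
  have h1 : Tendsto (fun n => qfin a q (n + 1)) atTop (𝓝 (qpoch a q)) :=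
    (tendsto_add_atTop_iff_nat 1).2 (qfin_tendsto a hq)
  refine tendsto_nhds_unique h1 (((qfin_tendsto (a * q) hq).const_mul (1 - a)).congr fun n => ?_)
  unfold qfin
  rw [Finset.prod_range_succ', mul_comm]
  congr 1
  · refine Finset.prod_congr rfl fun r _ => ?_
    ring
  · simp

/-- `∏_k (ζ^k q; ζ^k q)_∞ = (q⁵;q⁵)⁶ / (q²⁵;q²⁵)`. -/
lemma F_norm {q z : ℂ} (hq : ‖q‖ < 1) (hz : IsPrimitiveRoot z 5) :
    (∏ k ∈ Finset.range 5, qpoch (z ^ k * q) (z ^ k * q)) * qpoch (q ^ 25) (q ^ 25) =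
      qpoch (q ^ 5) (q ^ 5) ^ 6 := by
  have hz5 : z ^ 5 = 1 := hz.pow_eq_one
  have hzn : ‖z‖ = 1 := hz.norm'_eq_one (by norm_num)
  have hzq : ∀ k : ℕ, ‖z ^ k * q‖ < 1 := by
    intro k; simpa [norm_mul, norm_pow, hzn] using hq
  -- each factor splits in five
  have hs : ∀ k, qpoch (z ^ k * q) (z ^ k * q) =
      ∏ r ∈ Finset.range 5, qpoch (z ^ (k * (r + 1)) * q ^ (r + 1)) (q ^ 5) := by
    intro k
    rw [qpoch_split _ (hzq k) (m := 5) (by norm_num)]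
    refine Finset.prod_congr rfl fun r _ => ?_
    congr 1
    · ring
    · rw [mul_pow, ← pow_mul, mul_comm k 5, pow_mul, hz5, one_pow, one_mul]
  have hroot : ∀ x : ℂ, (∏ k ∈ Finset.range 5, (1 - z ^ k * x)) = 1 - x ^ 5 := by
    intro x
    have h4 : 1 + z + z ^ 2 + z ^ 3 + z ^ 4 = 0 := by
      have := hz.geom_sum_eq_zero (by norm_num)
      simpa [Finset.sum_range_succ] using this
    simp only [Finset.prod_range_succ, Finset.prod_range_zero]
    have h6 : z ^ 6 = z := by rw [pow_succ, hz5, one_mul]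
    have h7 : z ^ 7 = z ^ 2 := by rw [pow_add z 5 2, hz5, one_mul]
    have h8 : z ^ 8 = z ^ 3 := by rw [pow_add z 5 3, hz5, one_mul]
    have h9 : z ^ 9 = z ^ 4 := by rw [pow_add z 5 4, hz5, one_mul]
    have h10 : z ^ 10 = 1 := by rw [pow_mul z 5 2, hz5, one_pow]
    ring_nf
    simp only [hz5, h6, h7, h8, h9, h10]
    linear_combination (-x + 2 * x^2 - 2 * x^3 + x^4) * h4
  have hq5 : ‖q ^ 5‖ < 1 := norm_pow_lt_one hq (by norm_num)
  have hfin : ∀ (a : ℂ), (∏ k ∈ Finset.range 5, qpoch (z ^ k * a) (q ^ 5)) =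
      qpoch (a ^ 5) ((q ^ 5) ^ 5) := by
    intro a
    have h1 : Tendsto (fun n => ∏ k ∈ Finset.range 5, qfin (z ^ k * a) (q ^ 5) n) atTop
      (𝓝 (∏ k ∈ Finset.range 5, qpoch (z ^ k * a) (q ^ 5))) :=
      tendsto_finsetProd _ fun r _ => qfin_tendsto _ hq5
    refine tendsto_nhds_unique (h1.congr fun n => ?_)
      (qfin_tendsto (a ^ 5) (norm_pow_lt_one hq5 (by norm_num)))
    unfold qfin
    rw [Finset.prod_comm]
    refine Finset.prod_congr rfl fun r _ => ?_
    have := hroot (a * (q ^ 5) ^ r)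
    simp only [← mul_assoc] at this
    rw [this]
    ring
  have hperm : ∀ (a : ℂ) (m : ℕ), Nat.Coprime m 5 →
      (∏ k ∈ Finset.range 5, qpoch (z ^ (k * m) * a) (q ^ 5)) = qpoch (a ^ 5) ((q ^ 5) ^ 5) := by
    intro a m hm
    rw [← hfin a]
    have hmod : ∀ n, z ^ n = z ^ (n % 5) := fun n => by
      conv_lhs => rw [← Nat.mod_add_div n 5, pow_add, pow_mul, hz5, one_pow, mul_one]
    have hm5 : m % 5 = 1 ∨ m % 5 = 2 ∨ m % 5 = 3 ∨ m % 5 = 4 := by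
      have : m % 5 ≠ 0 := by
        intro h
        have h5 := Nat.dvd_of_mod_eq_zero h
        have := Nat.Coprime.eq_one_of_dvd hm.symm h5
        omega
      omega
    have hmm : ∀ k, z ^ (k * m) = z ^ ((k * (m % 5)) % 5) := by
      intro k; rw [hmod (k * m), Nat.mul_mod, Nat.mul_mod k (m % 5), Nat.mod_mod]
    simp only [hmm]
    rcases hm5 with h | h | h | h <;> simp [h, Finset.prod_range_succ] <;> ring
  simp only [hs]
  rw [Finset.prod_comm]
  rw [Finset.prod_range_succ]
  have hE : ∀ r ∈ Finset.range 4, (∏ k ∈ Finset.range 5,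
      qpoch (z ^ (k * (r + 1)) * q ^ (r + 1)) (q ^ 5)) = qpoch ((q ^ 5) * (q ^ 5) ^ r) ((q ^ 5) ^ 5) := by
    intro r hr
    rw [hperm _ (r + 1) (by
      have := Finset.mem_range.1 hr
      interval_cases r <;> decide)]
    congr 1
    ring
  rw [Finset.prod_congr rfl hE]
  have h5 : ∀ k, z ^ (k * (4 + 1)) = 1 := fun k => by
    rw [mul_comm, pow_mul, hz5, one_pow]
  simp only [h5, one_mul, Finset.prod_const, Finset.card_range]
  have h25 : qpoch (q ^ 25) (q ^ 25) = qpoch ((q ^ 5) * (q ^ 5) ^ 4) ((q ^ 5) ^ 5) := by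
    congr 1 <;> ring
  rw [h25, mul_right_comm, ← Finset.prod_range_succ (fun r => qpoch ((q ^ 5) * (q ^ 5) ^ r) ((q ^ 5) ^ 5)),
    ← qpoch_split _ hq5 (by norm_num)]
  ring

/-- Gaussian binomial coefficients. -/
noncomputable def gaussB (p : ℂ) : ℕ → ℕ → ℂ
  | _, 0 => 1
  | 0, _ + 1 => 0
  | M + 1, i + 1 => gaussB p M (i + 1) + p ^ (M - i) * gaussB p M i

lemma gaussB_zero_right (p : ℂ) (M : ℕ) : gaussB p M 0 = 1 := by
  cases M <;> rfl

lemma gaussB_succ (p : ℂ) (M i : ℕ) :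
    gaussB p (M + 1) (i + 1) = gaussB p M (i + 1) + p ^ (M - i) * gaussB p M i := rfl

lemma gaussB_eq_zero (p : ℂ) : ∀ (M i : ℕ), M < i → gaussB p M i = 0
  | _, 0, h => by omega
  | 0, _ + 1, _ => rfl
  | M + 1, i + 1, h => by
    rw [gaussB_succ, gaussB_eq_zero p M (i + 1) (by omega), gaussB_eq_zero p M i (by omega)]
    simp

lemma qfin_succ (a q : ℂ) (n : ℕ) : qfin a q (n + 1) = qfin a q n * (1 - a * q ^ n) := by
  unfold qfin; rw [Finset.prod_range_succ]

lemma gaussB_mul (p : ℂ) : ∀ (M i : ℕ), i ≤ M →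
    gaussB p M i * (qfin p p i * qfin p p (M - i)) = qfin p p M
  | M, 0, _ => by simp [gaussB_zero_right, qfin]
  | 0, i + 1, h => by omega
  | M + 1, i + 1, h => by
    have h2 := gaussB_mul p M i (by omega)
    rw [gaussB_succ, qfin_succ p p M, Nat.add_sub_add_right]
    rcases Nat.lt_or_ge i M with hlt | hge
    · have h1 := gaussB_mul p M (i + 1) (by omega)
      obtain ⟨j, rfl⟩ : ∃ j, M = i + 1 + j := ⟨M - (i + 1), by omega⟩
      have e1 : i + 1 + j - (i + 1) = j := by omega
      have e2 : i + 1 + j - i = j + 1 := by omega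
      rw [e1] at h1
      rw [e2] at h2 ⊢
      rw [qfin_succ p p j] at h2 ⊢
      rw [qfin_succ p p i] at h1 ⊢
      have e3 : p ^ (i + 1 + j) = p ^ i * p * p ^ j := by ring
      rw [e3, pow_succ p j]
      linear_combination (1 - p * p ^ j) * h1 + p * p ^ j * (1 - p * p ^ i) * h2
    · obtain rfl : i = M := by omega
      rw [gaussB_eq_zero p i (i + 1) (by omega), qfin_succ]
      simp only [Nat.sub_self, pow_zero] at h2 ⊢
      linear_combination (1 - p * p ^ i) * h2

lemma q_binomial (p x : ℂ) (M : ℕ) :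
    ∏ k ∈ Finset.range M, (1 + x * p ^ k) =
      ∑ i ∈ Finset.range (M + 1), p ^ (i.choose 2) * x ^ i * gaussB p M i := by
  induction M with
  | zero => simp [gaussB_zero_right]
  | succ M ih =>
    rw [Finset.prod_range_succ, ih, Finset.sum_range_succ' _ (M + 1)]
    simp only [gaussB_succ, gaussB_zero_right]
    have h1 : ∀ i ∈ Finset.range (M + 1),
        p ^ ((i + 1).choose 2) * x ^ (i + 1) * (gaussB p M (i + 1) + p ^ (M - i) * gaussB p M i) =
        p ^ ((i + 1).choose 2) * x ^ (i + 1) * gaussB p M (i + 1) +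
          x * p ^ M * (p ^ (i.choose 2) * x ^ i * gaussB p M i) := by
      intro i hi
      have hi' : i ≤ M := by have := Finset.mem_range.1 hi; omega
      have e : (i + 1).choose 2 = i.choose 2 + i := by
        rw [Nat.choose_succ_succ' i 1, Nat.choose_one_right, add_comm]
      have e2 : p ^ M = p ^ i * p ^ (M - i) := by rw [← pow_add]; congr 1; omega
      rw [e, e2, pow_add p]
      ring
    rw [Finset.sum_congr rfl h1, Finset.sum_add_distrib, ← Finset.mul_sum]
    have h2 := Finset.sum_range_succ' (fun i => p ^ (i.choose 2) * x ^ i * gaussB p M i) (M + 1)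
    rw [Finset.sum_range_succ _ (M + 1), gaussB_eq_zero p M (M + 1) (by omega)] at h2
    simp only [gaussB_zero_right] at h2
    linear_combination h2

lemma finite_jtp {Q w : ℂ} (hQ : Q ≠ 0) (hw : w ≠ 0) (N : ℕ) :
    qfin (-(w * Q)) (Q ^ 2) N * qfin (-(Q / w)) (Q ^ 2) N =
      ∑ i ∈ Finset.range (2 * N + 1),
        Q ^ (((i : ℤ) - N) ^ 2) * w ^ ((i : ℤ) - N) * gaussB (Q ^ 2) (2 * N) i := by
  have hb := q_binomial (Q ^ 2) (w * Q ^ (1 - 2 * (N : ℤ))) (2 * N)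
  have hL : ∏ k ∈ Finset.range (2 * N), (1 + w * Q ^ (1 - 2 * (N : ℤ)) * (Q ^ 2) ^ k) =
      w ^ (N : ℤ) * Q ^ (-(N : ℤ) ^ 2) *
        (qfin (-(w * Q)) (Q ^ 2) N * qfin (-(Q / w)) (Q ^ 2) N) := by
    rw [two_mul, Finset.prod_range_add, ← Finset.prod_range_reflect _ N]
    have hpow : ∀ n : ℕ, ∏ k ∈ Finset.range n, (w * Q ^ (-(2 * (k : ℤ) + 1))) =
        w ^ (n : ℤ) * Q ^ (-(n : ℤ) ^ 2) := by
      intro n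
      induction n with
      | zero => simp
      | succ n ih =>
        rw [Finset.prod_range_succ, ih]
        have : -((n + 1 : ℕ) : ℤ) ^ 2 = -(n : ℤ) ^ 2 + -(2 * (n : ℤ) + 1) := by push_cast; ring
        rw [this, zpow_add₀ hQ]
        push_cast
        rw [zpow_add₀ hw]
        simp only [zpow_one]; ring
    have h1 : ∏ k ∈ Finset.range N, (1 + w * Q ^ (1 - 2 * (N : ℤ)) * (Q ^ 2) ^ (N - 1 - k)) =
        w ^ (N : ℤ) * Q ^ (-(N : ℤ) ^ 2) * qfin (-(Q / w)) (Q ^ 2) N := by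
      rw [← hpow N]
      unfold qfin
      rw [← Finset.prod_mul_distrib]
      refine Finset.prod_congr rfl fun k hk => ?_
      have hk' := Finset.mem_range.1 hk
      have e1 : (Q ^ 2) ^ (N - 1 - k) = Q ^ (2 * (N : ℤ) - 2 - 2 * k) := by
        rw [← pow_mul, ← zpow_natCast]; congr 1; push_cast
        rw [Nat.cast_sub (by omega), Nat.cast_sub (by omega)]; push_cast; ring
      have e2 : Q / w * (Q ^ 2) ^ k = Q ^ (2 * (k : ℤ) + 1) / w := by
        rw [← pow_mul, zpow_add₀ hQ, zpow_one]
        have : Q ^ (2 * (k : ℤ)) = Q ^ (2 * k) := by rw [← zpow_natCast]; push_cast; rfl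
        rw [this]; ring
      rw [e1, neg_mul, e2, mul_assoc, ← zpow_add₀ hQ]
      have e3 : (1 - 2 * (N : ℤ) + (2 * N - 2 - 2 * k)) = -(2 * (k : ℤ) + 1) := by ring
      rw [e3, zpow_neg]
      have := zpow_ne_zero (2 * (k : ℤ) + 1) hQ
      field_simp
      ring
    have h2 : ∏ k ∈ Finset.range N, (1 + w * Q ^ (1 - 2 * (N : ℤ)) * (Q ^ 2) ^ (N + k)) =
        qfin (-(w * Q)) (Q ^ 2) N := by
      unfold qfin
      refine Finset.prod_congr rfl fun k hk => ?_
      have e1 : (Q ^ 2) ^ (N + k) = Q ^ (2 * (N : ℤ)) * (Q ^ 2) ^ k := by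
        rw [pow_add, ← pow_mul, ← zpow_natCast Q (2 * N)]; push_cast; rfl
      rw [e1, zpow_sub₀ hQ, zpow_one]
      have := zpow_ne_zero (2 * (N : ℤ)) hQ
      field_simp
      ring
    rw [h1, h2]; ring
  rw [hL] at hb
  have hne : w ^ (N : ℤ) * Q ^ (-(N : ℤ) ^ 2) ≠ 0 :=
    mul_ne_zero (zpow_ne_zero _ hw) (zpow_ne_zero _ hQ)
  apply mul_left_cancel₀ hne
  rw [hb, Finset.mul_sum]
  refine Finset.sum_congr rfl fun i _ => ?_
  have e1 : (Q ^ 2) ^ (i.choose 2) = Q ^ ((i : ℤ) * (i - 1)) := by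
    rw [← pow_mul, ← zpow_natCast]
    congr 1
    have h := Nat.choose_two_right i
    have h2 : 2 * i.choose 2 = i * (i - 1) := by
      rw [h, Nat.mul_div_cancel' (Nat.even_mul_pred_self i).two_dvd]
    rw [h2]
    cases i <;> push_cast <;> simp
  have e2 : (w * Q ^ (1 - 2 * (N : ℤ))) ^ i = w ^ (i : ℤ) * Q ^ ((1 - 2 * (N : ℤ)) * i) := by
    rw [mul_pow, zpow_mul, zpow_natCast, zpow_natCast]
  rw [e1, e2]
  have e3 : w ^ (i : ℤ) = w ^ (N : ℤ) * w ^ ((i : ℤ) - N) := by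
    rw [← zpow_add₀ hw]; congr 1; ring
  have e4 : Q ^ ((i : ℤ) * (i - 1)) * Q ^ ((1 - 2 * (N : ℤ)) * i) =
      Q ^ (-(N : ℤ) ^ 2) * Q ^ (((i : ℤ) - N) ^ 2) := by
    rw [← zpow_add₀ hQ, ← zpow_add₀ hQ]; congr 1; ring
  rw [e3]
  linear_combination (w ^ (N : ℤ) * w ^ ((i : ℤ) - N) * gaussB (Q ^ 2) (2 * N) i) * e4

lemma gaussB_eq_div {p : ℂ} (hp : ‖p‖ < 1) {M i : ℕ} (h : i ≤ M) :
    gaussB p M i = qfin p p M * (qfin p p i)⁻¹ * (qfin p p (M - i))⁻¹ := by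
  have h1 := qfin_ne_zero hp i
  have h2 := qfin_ne_zero hp (M - i)
  rw [← gaussB_mul p M i h]
  field_simp

lemma gaussB_bound {p : ℂ} (hp : ‖p‖ < 1) : ∃ C : ℝ, ∀ M i, ‖gaussB p M i‖ ≤ C := by
  have ht := qfin_tendsto p hp
  obtain ⟨C1, hC1⟩ := ht.norm.bddAbove_range
  obtain ⟨C2, hC2⟩ := (ht.inv₀ (F_ne_zero hp)).norm.bddAbove_range
  have h1 : ∀ n, ‖qfin p p n‖ ≤ C1 := fun n => hC1 ⟨n, rfl⟩
  have h2 : ∀ n, ‖(qfin p p n)⁻¹‖ ≤ C2 := fun n => hC2 ⟨n, rfl⟩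
  have hC1' : 0 ≤ C1 := (norm_nonneg _).trans (h1 0)
  have hC2' : 0 ≤ C2 := (norm_nonneg _).trans (h2 0)
  refine ⟨C1 * C2 * C2, fun M i => ?_⟩
  rcases Nat.lt_or_ge M i with h | h
  · rw [gaussB_eq_zero p M i h, norm_zero]; positivity
  · rw [gaussB_eq_div hp h, norm_mul, norm_mul]
    gcongr
    · exact h1 _
    · exact h2 _
    · exact h2 _

/-- Tannery's theorem for central Gaussian binomials. -/
lemma tannery {p : ℂ} (hp : ‖p‖ < 1) {a : ℤ → ℂ} (ha : Summable fun n => ‖a n‖) :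
    Tendsto (fun N : ℕ => ∑ i ∈ Finset.range (2 * N + 1), a ((i : ℤ) - N) * gaussB p (2 * N) i)
      atTop (𝓝 ((∑' n, a n) * (qpoch p p)⁻¹)) := by
  obtain ⟨C, hC⟩ := gaussB_bound hp
  have hC0 : 0 ≤ C := (norm_nonneg _).trans (hC 0 0)
  set f : ℕ → ℤ → ℂ := fun N j =>
    if 0 ≤ j + N then a j * gaussB p (2 * N) (j + N).toNat else 0 with hf
  have hsum : ∀ N : ℕ, ∑ i ∈ Finset.range (2 * N + 1), a ((i : ℤ) - N) * gaussB p (2 * N) i =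
      ∑' j, f N j := by
    intro N
    have hinj : Function.Injective (fun i : ℕ => (i : ℤ) - N) := by
      intro x y h; simpa using h
    rw [← hinj.tsum_eq (f := f N)]
    · rw [tsum_eq_sum (s := Finset.range (2 * N + 1))]
      · refine Finset.sum_congr rfl fun i _ => ?_
        simp [hf]
      · intro i hi
        have : 2 * N < i := by simpa using hi
        simp [hf, gaussB_eq_zero p _ _ this]
    · intro j hj
      have : 0 ≤ j + N := by
        by_contra h
        simp [hf, h] at hj
      exact ⟨(j + N).toNat, by simp [Int.toNat_of_nonneg this]⟩
  simp only [hsum]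
  rw [← tsum_mul_right]
  refine tendsto_tsum_of_dominated_convergence (bound := fun j => ‖a j‖ * C) (ha.mul_right C) ?_ ?_
  · intro j
    have ht := qfin_tendsto p hp
    have hF := F_ne_zero hp
    have t1 : Tendsto (fun N : ℕ => qfin p p (2 * N)) atTop (𝓝 (qpoch p p)) :=
      ht.comp (tendsto_id.const_mul_atTop' (by norm_num))
    have t2 : Tendsto (fun N : ℕ => (j + N).toNat) atTop atTop := by
      refine tendsto_atTop.2 fun b => ?_
      filter_upwards [eventually_ge_atTop (b + j.natAbs)] with N hN
      omega
    have t3 : Tendsto (fun N : ℕ => 2 * N - (j + N).toNat) atTop atTop := by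
      refine tendsto_atTop.2 fun b => ?_
      filter_upwards [eventually_ge_atTop (b + j.natAbs)] with N hN
      omega
    have t := ((t1.mul ((ht.comp t2).inv₀ hF)).mul ((ht.comp t3).inv₀ hF)).const_mul (a j)
    have e : a j * (qpoch p p * (qpoch p p)⁻¹ * (qpoch p p)⁻¹) = a j * (qpoch p p)⁻¹ := by
      rw [mul_inv_cancel₀ hF, one_mul]
    rw [e] at t
    refine t.congr' ?_
    filter_upwards [eventually_ge_atTop j.natAbs] with N hN
    have h0 : 0 ≤ j + N := by omega
    have h1 : (j + N).toNat ≤ 2 * N := by omega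
    simp only [hf, if_pos h0, Function.comp]
    rw [gaussB_eq_div hp h1]
  · refine Eventually.of_forall fun N j => ?_
    simp only [hf]
    split_ifs
    · rw [norm_mul]
      exact mul_le_mul_of_nonneg_left (hC _ _) (norm_nonneg _)
    · simp only [norm_zero]; positivity

lemma theta_summable_pow {Q w : ℂ} (hQ1 : ‖Q‖ < 1) (hQ : Q ≠ 0) (hw : w ≠ 0) (k : ℕ) :
    Summable fun n : ℤ => ‖(n : ℂ) ^ k * (Q ^ (n ^ 2) * w ^ n)‖ := by
  have hQp : 0 < ‖Q‖ := norm_pos_iff.2 hQ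
  have hwp : 0 < ‖w‖ := norm_pos_iff.2 hw
  have hlog : Real.log ‖Q‖ < 0 := Real.log_neg hQp hQ1
  have hT : 0 < -Real.log ‖Q‖ / Real.pi := div_pos (by linarith) Real.pi_pos
  refine Summable.of_nonneg_of_le (fun _ => norm_nonneg _) (fun n => ?_)
    (summable_pow_mul_jacobiTheta₂_term_bound (|Real.log ‖w‖| / (2 * Real.pi)) hT k)
  have e1 : ‖Q ^ (n ^ 2) * w ^ n‖ = Real.exp (Real.log ‖Q‖ * n ^ 2 + Real.log ‖w‖ * n) := by
    rw [norm_mul, norm_zpow, norm_zpow, Real.exp_add, ← Real.rpow_intCast, ← Real.rpow_intCast,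
      Real.rpow_def_of_pos hQp, Real.rpow_def_of_pos hwp]
    push_cast; rfl
  rw [norm_mul, e1, norm_pow]
  have e2 : ‖(n : ℂ)‖ ^ k = ((|n| ^ k : ℤ) : ℝ) := by
    rw [Complex.norm_intCast]; push_cast; rfl
  rw [e2]
  push_cast
  refine mul_le_mul_of_nonneg_left ?_ (by positivity)
  apply Real.exp_le_exp.2
  have hpi := Real.pi_pos
  have e3 : -Real.pi * (-Real.log ‖Q‖ / Real.pi * (n : ℝ) ^ 2 -
      2 * (|Real.log ‖w‖| / (2 * Real.pi)) * |(n : ℝ)|) =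
      Real.log ‖Q‖ * n ^ 2 + |Real.log ‖w‖| * |(n : ℝ)| := by
    field_simp
    ring
  have h4 : Real.log ‖w‖ * n ≤ |Real.log ‖w‖| * |(n : ℝ)| := by
    rw [← abs_mul]; exact le_abs_self _
  rw [e3]
  linarith

/-- The theta series `∑ Q^{n²} w^n`. -/
noncomputable def thetaT (Q w : ℂ) : ℂ := ∑' n : ℤ, Q ^ (n ^ 2) * w ^ n

lemma theta_summable_norm {Q w : ℂ} (hQ1 : ‖Q‖ < 1) (hQ : Q ≠ 0) (hw : w ≠ 0) :
    Summable fun n : ℤ => ‖Q ^ (n ^ 2) * w ^ n‖ := by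
  simpa using theta_summable_pow hQ1 hQ hw 0

/-- Jacobi triple product. -/
lemma jtp {Q w : ℂ} (hQ1 : ‖Q‖ < 1) (hQ : Q ≠ 0) (hw : w ≠ 0) :
    thetaT Q w = qpoch (Q ^ 2) (Q ^ 2) * (qpoch (-(w * Q)) (Q ^ 2) * qpoch (-(Q / w)) (Q ^ 2)) := by
  have hp : ‖Q ^ 2‖ < 1 := norm_pow_lt_one hQ1 two_ne_zero
  have h1 := tannery hp (theta_summable_norm hQ1 hQ hw)
  have h2 := (qfin_tendsto (-(w * Q)) hp).mul (qfin_tendsto (-(Q / w)) hp)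
  have h3 := tendsto_nhds_unique h1 (h2.congr fun N => finite_jtp hQ hw N)
  have hF := F_ne_zero hp
  unfold thetaT
  rw [← h3]
  field_simp

/-- Jacobi's identity for the cube. -/
lemma jacobi_cube {s : ℂ} (hs1 : ‖s‖ < 1) (hs : s ≠ 0) :
    ∑' n : ℤ, (n : ℂ) * (s ^ (n ^ 2) * (-s⁻¹) ^ n) = - qpoch (s ^ 2) (s ^ 2) ^ 3 := by
  have hp : ‖s ^ 2‖ < 1 := norm_pow_lt_one hs1 two_ne_zero
  have hw : -s⁻¹ ≠ 0 := neg_ne_zero.2 (inv_ne_zero hs)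
  have hsm := theta_summable_pow hs1 hs hw 1
  simp only [pow_one] at hsm
  have h1 := tannery hp hsm
  have hF := F_ne_zero hp
  have key : ∀ N : ℕ, ∑ i ∈ Finset.range (2 * (N + 1) + 1),
      (((i : ℤ) - (N + 1 : ℕ) : ℤ) : ℂ) * (s ^ (((i : ℤ) - (N + 1 : ℕ)) ^ 2) *
        (-s⁻¹) ^ ((i : ℤ) - (N + 1 : ℕ))) * gaussB (s ^ 2) (2 * (N + 1)) i =
      - (qfin (s ^ 2) (s ^ 2) N * qfin (s ^ 2) (s ^ 2) (N + 1)) := by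
    intro N
    set w0 : ℂ := -s⁻¹ with hw0
    -- product side
    set g : ℂ → ℂ := fun w => qfin (-(w * s * s ^ 2)) (s ^ 2) N * qfin (-(s / w)) (s ^ 2) (N + 1) with hg
    have hprod : ∀ w, qfin (-(w * s)) (s ^ 2) (N + 1) * qfin (-(s / w)) (s ^ 2) (N + 1) =
        (1 + w * s) * g w := by
      intro w
      simp only [hg]
      rw [← mul_assoc]
      congr 1
      unfold qfin
      rw [Finset.prod_range_succ', mul_comm]
      congr 1
      · simp
      · refine Finset.prod_congr rfl fun k _ => ?_
        ring
    have hgd : DifferentiableAt ℂ g w0 := by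
      simp only [hg]
      unfold qfin
      fun_prop (disch := exact hw)
    have hd1 : HasDerivAt (fun w => (1 + w * s) * g w) (s * g w0 + (1 + w0 * s) * deriv g w0) w0 := by
      have ha : HasDerivAt (fun w : ℂ => 1 + w * s) s w0 := by
        simpa using ((hasDerivAt_id w0).mul_const s).const_add 1
      exact ha.mul hgd.hasDerivAt
    have hz : 1 + w0 * s = 0 := by rw [hw0]; field_simp; ring
    rw [hz, zero_mul, add_zero] at hd1
    have hd2 : HasDerivAt (fun w => ∑ i ∈ Finset.range (2 * (N + 1) + 1),
        s ^ (((i : ℤ) - (N + 1 : ℕ)) ^ 2) * w ^ ((i : ℤ) - (N + 1 : ℕ)) *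
          gaussB (s ^ 2) (2 * (N + 1)) i)
        (∑ i ∈ Finset.range (2 * (N + 1) + 1),
        s ^ (((i : ℤ) - (N + 1 : ℕ)) ^ 2) * ((((i : ℤ) - (N + 1 : ℕ) : ℤ) : ℂ) *
          w0 ^ ((i : ℤ) - (N + 1 : ℕ) - 1)) *
          gaussB (s ^ 2) (2 * (N + 1)) i) w0 := by
      refine HasDerivAt.fun_sum fun i _ => ?_
      exact ((hasDerivAt_zpow _ w0 (Or.inl hw)).const_mul _).mul_const _
    have heq : (fun w => (1 + w * s) * g w) =ᶠ[𝓝 w0] (fun w => ∑ i ∈ Finset.range (2 * (N + 1) + 1),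
        s ^ (((i : ℤ) - (N + 1 : ℕ)) ^ 2) * w ^ ((i : ℤ) - (N + 1 : ℕ)) *
          gaussB (s ^ 2) (2 * (N + 1)) i) := by
      filter_upwards [isOpen_ne.mem_nhds hw] with w hw'
      rw [← hprod w]
      exact finite_jtp hs hw' (N + 1)
    have hu := (hd2.congr_of_eventuallyEq heq).unique hd1
    have hu2 := congrArg (fun t => w0 * t) hu
    simp only [Finset.mul_sum] at hu2
    have hl : w0 * (s * g w0) = - (qfin (s ^ 2) (s ^ 2) N * qfin (s ^ 2) (s ^ 2) (N + 1)) := by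
      have e1 : -(w0 * s * s ^ 2) = s ^ 2 := by linear_combination (-s ^ 2) * hz
      have e2 : -(s / w0) = s ^ 2 := by rw [hw0]; field_simp
      simp only [hg, e1, e2]
      linear_combination (qfin (s ^ 2) (s ^ 2) N * qfin (s ^ 2) (s ^ 2) (N + 1)) * hz
    rw [hl] at hu2
    rw [← hu2]
    refine Finset.sum_congr rfl fun i _ => ?_
    rw [zpow_sub_one₀ hw]
    field_simp
  have h2 := (tendsto_add_atTop_iff_nat 1).2 h1
  have ht := qfin_tendsto (s ^ 2) hp
  have h3 := (ht.mul ((tendsto_add_atTop_iff_nat 1).2 ht)).neg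
  have h4 := tendsto_nhds_unique h2 (h3.congr fun N => (key N).symm)
  have h5 := congrArg (fun t => t * qpoch (s ^ 2) (s ^ 2)) h4
  simp only [mul_assoc, inv_mul_cancel₀ hF, mul_one] at h5
  rw [h5]
  ring

lemma thetaT_inv (Q w : ℂ) : thetaT Q w⁻¹ = thetaT Q w := by
  unfold thetaT
  rw [← (Equiv.neg ℤ).tsum_eq]
  refine tsum_congr fun n => ?_
  simp

lemma thetaT_shift {Q w : ℂ} (hQ : Q ≠ 0) (hw : w ≠ 0) :
    thetaT Q w = Q * w * thetaT Q (Q ^ 2 * w) := by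
  unfold thetaT
  rw [← (Equiv.addRight (1 : ℤ)).tsum_eq, ← tsum_mul_left]
  refine tsum_congr fun n => ?_
  simp only [Equiv.coe_addRight]
  have e : (n + 1) ^ 2 = n ^ 2 + 2 * n + 1 := by ring
  rw [e, zpow_add₀ hQ, zpow_add₀ hQ, zpow_add₀ hw, mul_zpow, zpow_mul]
  simp only [zpow_one]
  norm_cast
  ring

/-- Splitting `ℤ` in residue classes mod 5. -/
def dissEquiv : Fin 5 × ℤ ≃ ℤ where
  toFun x := 5 * x.2 + ((x.1 : ℕ) : ℤ) - 2
  invFun n := (⟨((n + 2) % 5).toNat, by omega⟩, (n + 2) / 5)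
  left_inv := by
    rintro ⟨r, k⟩
    have := r.2
    ext <;> simp <;> omega
  right_inv := by
    intro n
    simp only
    omega

/-- Splitting `ℤ²` by multiplication with a Gaussian prime above 5. -/
def dissEquiv2 : Fin 5 × (ℤ × ℤ) ≃ ℤ × ℤ where
  toFun x := (x.2.1 + 2 * x.2.2 + ((x.1 : ℕ) : ℤ) - 2, 2 * x.2.1 - x.2.2)
  invFun n := (⟨((n.1 + 2 * n.2 + 2) % 5).toNat, by omega⟩,
    ((n.1 + 2 * n.2 + 2) / 5, 2 * ((n.1 + 2 * n.2 + 2) / 5) - n.2))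
  left_inv := by
    rintro ⟨r, k, l⟩
    have := r.2
    ext <;> simp <;> omega
  right_inv := by
    rintro ⟨i, j⟩
    ext
    · simp only
      omega
    · simp only
      omega

lemma diss_term {Q R w : ℂ} (hQ : Q ≠ 0) (hw : w ≠ 0)
    (hR : ∀ n : ℤ, R ^ n = Q ^ (25 * n)) (n ρ : ℤ) :
    Q ^ ((5 * n + ρ) ^ 2) * w ^ (5 * n + ρ) =
      Q ^ ρ ^ 2 * w ^ ρ * (R ^ n ^ 2 * (Q ^ (10 * ρ) * w ^ 5) ^ n) := by
  have e1 : (5 * n + ρ) ^ 2 = ρ ^ 2 + 25 * n ^ 2 + 10 * ρ * n := by ring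
  have ew : ∀ n : ℤ, (w ^ 5) ^ n = w ^ (5 * n) := fun n => by
    rw [zpow_mul, zpow_ofNat]
  rw [hR, mul_zpow, ew, ← zpow_mul, e1, zpow_add₀ hQ, zpow_add₀ hQ, zpow_add₀ hw]
  ring

lemma theta_diss_aux {Q R w : ℂ} (hQ1 : ‖Q‖ < 1) (hQ : Q ≠ 0) (hw : w ≠ 0)
    (hR : ∀ n : ℤ, R ^ n = Q ^ (25 * n)) :
    thetaT Q w = ∑ r : Fin 5, Q ^ ((((r : ℕ) : ℤ) - 2) ^ 2) * w ^ (((r : ℕ) : ℤ) - 2) *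
      thetaT R (Q ^ (10 * (((r : ℕ) : ℤ) - 2)) * w ^ 5) := by
  have hs := (theta_summable_norm hQ1 hQ hw).of_norm
  have h1 : thetaT Q w = ∑' x : Fin 5 × ℤ,
      Q ^ ((dissEquiv x) ^ 2) * w ^ (dissEquiv x) :=
    (dissEquiv.tsum_eq fun n : ℤ => Q ^ (n ^ 2) * w ^ n).symm
  have h2 : Summable fun x : Fin 5 × ℤ => Q ^ ((dissEquiv x) ^ 2) * w ^ (dissEquiv x) :=
    (dissEquiv.summable_iff (f := fun n : ℤ => Q ^ (n ^ 2) * w ^ n)).2 hs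
  rw [h1, Summable.tsum_prod h2, tsum_fintype]
  refine Finset.sum_congr rfl fun r _ => ?_
  unfold thetaT
  rw [← tsum_mul_left]
  refine tsum_congr fun n => ?_
  have e : dissEquiv (r, n) = 5 * n + (((r : ℕ) : ℤ) - 2) := by
    simp only [dissEquiv, Equiv.coe_fn_mk]; omega
  rw [e]
  exact diss_term hQ hw hR n _

lemma theta_diss {Q w : ℂ} (hQ1 : ‖Q‖ < 1) (hQ : Q ≠ 0) (hw : w ≠ 0) :
    thetaT Q w = ∑ r : Fin 5, Q ^ ((((r : ℕ) : ℤ) - 2) ^ 2) * w ^ (((r : ℕ) : ℤ) - 2) *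
      thetaT (Q ^ 25) (Q ^ (10 * (((r : ℕ) : ℤ) - 2)) * w ^ 5) :=
  theta_diss_aux hQ1 hQ hw fun n => by rw [zpow_mul, zpow_ofNat]

lemma theta_diss2 {s x y : ℂ} (hs1 : ‖s‖ < 1) (hs : s ≠ 0) (hx : x ≠ 0) (hy : y ≠ 0) :
    thetaT s x * thetaT s y = ∑ r : Fin 5, s ^ ((((r : ℕ) : ℤ) - 2) ^ 2) * x ^ (((r : ℕ) : ℤ) - 2) *
      (thetaT (s ^ 5) (s ^ (2 * (((r : ℕ) : ℤ) - 2)) * (x * y ^ 2)) *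
       thetaT (s ^ 5) (s ^ (4 * (((r : ℕ) : ℤ) - 2)) * (x ^ 2 / y))) := by
  have h5 : ‖s ^ 5‖ < 1 := norm_pow_lt_one hs1 (by norm_num)
  have h50 : s ^ 5 ≠ 0 := pow_ne_zero _ hs
  have hsx := theta_summable_norm hs1 hs hx
  have hsy := theta_summable_norm hs1 hs hy
  have hprod := summable_mul_of_summable_norm hsx hsy
  have h1 : thetaT s x * thetaT s y = ∑' z : Fin 5 × (ℤ × ℤ),
      (s ^ ((dissEquiv2 z).1 ^ 2) * x ^ (dissEquiv2 z).1) *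
      (s ^ ((dissEquiv2 z).2 ^ 2) * y ^ (dissEquiv2 z).2) := by
    unfold thetaT
    rw [tsum_mul_tsum_of_summable_norm hsx hsy]
    exact (dissEquiv2.tsum_eq fun n : ℤ × ℤ =>
      (s ^ (n.1 ^ 2) * x ^ n.1) * (s ^ (n.2 ^ 2) * y ^ n.2)).symm
  refine (h1.trans (Summable.tsum_prod (dissEquiv2.summable_iff.2 hprod))).trans ?_
  rw [tsum_fintype]
  refine Finset.sum_congr rfl fun r _ => ?_
  generalize hρ : (((r : ℕ) : ℤ) - 2) = ρ
  have ha : s ^ (2 * ρ) * (x * y ^ 2) ≠ 0 :=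
    mul_ne_zero (zpow_ne_zero _ hs) (mul_ne_zero hx (pow_ne_zero _ hy))
  have hb : s ^ (4 * ρ) * (x ^ 2 / y) ≠ 0 :=
    mul_ne_zero (zpow_ne_zero _ hs) (div_ne_zero (pow_ne_zero _ hx) hy)
  unfold thetaT
  rw [tsum_mul_tsum_of_summable_norm (theta_summable_norm h5 h50 ha)
    (theta_summable_norm h5 h50 hb), ← tsum_mul_left]
  refine tsum_congr ?_
  rintro ⟨k, l⟩
  have e : dissEquiv2 (r, (k, l)) = (k + 2 * l + ρ, 2 * k - l) := by
    simp only [dissEquiv2, Equiv.coe_fn_mk]; ext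
    · simp only; omega
    · simp only
  rw [e]
  simp only
  have e0 : ∀ n : ℤ, (s ^ 5) ^ n = s ^ (5 * n) := fun n => by
    rw [zpow_mul]; norm_cast
  have ex : ∀ n : ℤ, (x ^ 2) ^ n = x ^ (2 * n) := fun n => by
    rw [zpow_mul]; norm_cast
  have ey : ∀ n : ℤ, (y ^ 2) ^ n = y ^ (2 * n) := fun n => by
    rw [zpow_mul]; norm_cast
  rw [e0, e0, mul_zpow, mul_zpow, mul_zpow, div_zpow, ex, ey, ← zpow_mul, ← zpow_mul]
  have es : s ^ ((k + 2 * l + ρ) ^ 2) * s ^ ((2 * k - l) ^ 2) =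
      s ^ (ρ ^ 2) * s ^ (5 * k ^ 2) * s ^ (2 * ρ * k) * s ^ (5 * l ^ 2) * s ^ (4 * ρ * l) := by
    simp only [← zpow_add₀ hs]; congr 1; ring
  rw [zpow_add₀ hx, zpow_add₀ hx, zpow_sub₀ hy]
  have hyl := zpow_ne_zero l hy
  field_simp
  linear_combination es

lemma exists_sqrt {q : ℂ} (hq : ‖q‖ < 1) (hq0 : q ≠ 0) :
    ∃ s : ℂ, s ^ 2 = q ∧ ‖s‖ < 1 ∧ s ≠ 0 := by
  obtain ⟨s, hs⟩ := IsAlgClosed.exists_pow_nat_eq q (n := 2) (by norm_num)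
  refine ⟨s, hs, ?_, ?_⟩
  · by_contra h
    push Not at h
    have : 1 ≤ ‖s ^ 2‖ := by rw [norm_pow]; exact one_le_pow₀ h
    rw [hs] at this; linarith
  · rintro rfl; apply hq0; rw [← hs]; simp

lemma neg_poch {q : ℂ} (hq : ‖q‖ < 1) :
    qpoch q q * qpoch (-q) q = qpoch (q ^ 2) (q ^ 2) := qpoch_mul_neg q hq

lemma odd_poch {q : ℂ} (hq : ‖q‖ < 1) :
    qpoch q (q ^ 2) * qpoch (q ^ 2) (q ^ 2) = qpoch q q := by
  rw [qpoch_split q hq (m := 2) two_ne_zero]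
  simp only [Finset.prod_range_succ, Finset.prod_range_zero, pow_zero, mul_one, one_mul, pow_one,
    ← pow_two]

lemma theta_psi {s : ℂ} (hs1 : ‖s‖ < 1) (hs : s ≠ 0) :
    thetaT s s * qpoch (s ^ 2) (s ^ 2) = 2 * qpoch ((s ^ 2) ^ 2) ((s ^ 2) ^ 2) ^ 2 := by
  have hq : ‖s ^ 2‖ < 1 := norm_pow_lt_one hs1 two_ne_zero
  rw [jtp hs1 hs hs, div_self hs, ← pow_two, ← neg_poch hq, qpoch_head (-1) hq, neg_one_mul]
  ring

lemma theta_phi {q : ℂ} (hq : ‖q‖ < 1) (hq0 : q ≠ 0) :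
    thetaT q (-1) * qpoch (q ^ 2) (q ^ 2) = qpoch q q ^ 2 := by
  rw [jtp hq hq0 (by norm_num), ← odd_poch hq]
  have e1 : -(-1 * q) = q := by ring
  have e2 : -(q / -1) = q := by ring
  rw [e1, e2]
  ring

lemma split5 (a : ℂ) {q : ℂ} (hq : ‖q‖ < 1) : qpoch a q = qpoch a (q ^ 5) * qpoch (a * q) (q ^ 5) *
    qpoch (a * q ^ 2) (q ^ 5) * qpoch (a * q ^ 3) (q ^ 5) * qpoch (a * q ^ 4) (q ^ 5) := by
  rw [qpoch_split a hq (m := 5) (by norm_num)]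
  simp only [Finset.prod_range_succ, Finset.prod_range_zero, pow_zero, mul_one, one_mul, pow_one]

lemma rel_psi {q : ℂ} (hq : ‖q‖ < 1) (hq0 : q ≠ 0) :
    (qpoch (q ^ 2) (q ^ 2) ^ 2 / qpoch q q) ^ 2 -
      q * (qpoch (q ^ 10) (q ^ 10) ^ 2 / qpoch (q ^ 5) (q ^ 5)) ^ 2 =
    qpoch (q ^ 2) (q ^ 2) * qpoch (q ^ 5) (q ^ 5) ^ 3 / (qpoch q q * qpoch (q ^ 10) (q ^ 10)) := by
  obtain ⟨s, rfl, hs1, hs⟩ := exists_sqrt hq hq0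
  have hs5 : ‖s ^ 5‖ < 1 := norm_pow_lt_one hs1 (by norm_num)
  have hs50 : s ^ 5 ≠ 0 := pow_ne_zero _ hs
  have hq5 : ‖(s ^ 2) ^ 5‖ < 1 := norm_pow_lt_one hq (by norm_num)
  have hq10 : ‖(s ^ 2) ^ 10‖ < 1 := norm_pow_lt_one hq (by norm_num)
  have n1 := F_ne_zero hq
  have n5 := F_ne_zero hq5
  have n10 := F_ne_zero hq10
  have p1 := theta_psi hs1 hs
  have p5 := theta_psi hs5 hs50
  have e25 : (s ^ 5) ^ 2 = (s ^ 2) ^ 5 := by ring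
  have e210 : ((s ^ 2) ^ 5) ^ 2 = (s ^ 2) ^ 10 := by ring
  rw [e25, e210] at p5
  have hd := theta_diss2 hs1 hs hs hs
  rw [Fin.sum_univ_five] at hd
  simp only [Fin.val_zero, Fin.val_one, Fin.val_two, Fin.isValue] at hd
  have v3 : ((3 : Fin 5) : ℕ) = 3 := rfl
  have v4 : ((4 : Fin 5) : ℕ) = 4 := rfl
  rw [v3, v4] at hd
  norm_num at hd
  have i1 : thetaT (s ^ 5) s⁻¹ = thetaT (s ^ 5) s := thetaT_inv _ _
  have i3 : thetaT (s ^ 5) (s ^ 3)⁻¹ = thetaT (s ^ 5) (s ^ 3) := thetaT_inv _ _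
  have i7 : thetaT (s ^ 5) (s ^ 7)⁻¹ = thetaT (s ^ 5) (s ^ 7) := thetaT_inv _ _
  have j1 := thetaT_shift hs50 (inv_ne_zero hs)
  have j3 := thetaT_shift hs50 (inv_ne_zero (pow_ne_zero 3 hs))
  have k1 : (s ^ 5) ^ 2 * s⁻¹ = s ^ 9 := by field_simp
  have k3 : (s ^ 5) ^ 2 * (s ^ 3)⁻¹ = s ^ 7 := by field_simp
  have l1 : s ^ 5 * s⁻¹ = s ^ 4 := by field_simp
  have l3 : s ^ 5 * (s ^ 3)⁻¹ = s ^ 2 := by field_simp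
  rw [k1, l1, i1] at j1
  rw [k3, l3, i3] at j3
  have a1 : (s ^ 4)⁻¹ * (s * s ^ 2) = s⁻¹ := by field_simp
  have a2 : (s ^ 8)⁻¹ * (s ^ 2 / s) = (s ^ 7)⁻¹ := by field_simp
  have a3 : (s ^ 2)⁻¹ * (s * s ^ 2) = s := by field_simp
  have a4 : (s ^ 4)⁻¹ * (s ^ 2 / s) = (s ^ 3)⁻¹ := by field_simp
  have a5 : s * s ^ 2 = s ^ 3 := by ring
  have a6 : s ^ 2 / s = s := by field_simp
  have a7 : s ^ 2 * (s * s ^ 2) = s ^ 5 := by ring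
  have a8 : s ^ 4 * (s ^ 2 / s) = s ^ 5 := by field_simp
  have a9 : s ^ 4 * (s * s ^ 2) = s ^ 7 := by ring
  have a10 : s ^ 8 * (s ^ 2 / s) = s ^ 9 := by field_simp
  have a11 : s ^ 4 * (s ^ 2)⁻¹ = s ^ 2 := by field_simp
  rw [a1, a2, a3, a4, a7, a8, a9, a10, a5, a6, a11, mul_inv_cancel₀ hs, i1, i7, i3] at hd
  have main : thetaT s s ^ 2 = 4 * (thetaT (s ^ 5) s * thetaT (s ^ 5) (s ^ 3)) +
      s ^ 2 * thetaT (s ^ 5) (s ^ 5) ^ 2 := by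
    linear_combination hd - thetaT (s ^ 5) s * j3 - s ^ 2 * thetaT (s ^ 5) (s ^ 7) * j1 -
      thetaT (s ^ 5) s * j3
  have t1 := jtp hs5 hs50 hs
  have t3 := jtp hs5 hs50 (pow_ne_zero 3 hs)
  have np := neg_poch hq
  have np5 := neg_poch hq5
  rw [split5 (-(s ^ 2)) hq] at np
  have b1 : -(s * s ^ 5) = -(s ^ 2) * (s ^ 2) ^ 2 := by ring
  have b2 : -(s ^ 5 / s) = -(s ^ 2) * s ^ 2 := by field_simp
  have b3 : -(s ^ 3 * s ^ 5) = -(s ^ 2) * (s ^ 2) ^ 3 := by ring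
  have b4 : -(s ^ 5 / s ^ 3) = -(s ^ 2) := by field_simp
  have b5 : -(s ^ 2) * (s ^ 2) ^ 4 = -((s ^ 2) ^ 5) := by ring
  rw [e25, b1, b2] at t1
  rw [e25, b3, b4] at t3
  rw [b5] at np
  rw [e210] at np5
  have prod : thetaT (s ^ 5) s * thetaT (s ^ 5) (s ^ 3) *
      (qpoch (s ^ 2) (s ^ 2) * qpoch ((s ^ 2) ^ 10) ((s ^ 2) ^ 10)) =
      qpoch ((s ^ 2) ^ 2) ((s ^ 2) ^ 2) * qpoch ((s ^ 2) ^ 5) ((s ^ 2) ^ 5) ^ 3 := by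
    rw [t1, t3, ← np, ← np5]; ring
  generalize thetaT s s = A at *
  generalize thetaT (s ^ 5) (s ^ 5) = B at *
  generalize thetaT (s ^ 5) s * thetaT (s ^ 5) (s ^ 3) = C at *
  have p1' : qpoch ((s ^ 2) ^ 2) ((s ^ 2) ^ 2) ^ 2 / qpoch (s ^ 2) (s ^ 2) = A / 2 := by
    rw [div_eq_iff n1]; linear_combination -p1 / 2
  have p5' : qpoch ((s ^ 2) ^ 10) ((s ^ 2) ^ 10) ^ 2 / qpoch ((s ^ 2) ^ 5) ((s ^ 2) ^ 5) = B / 2 := by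
    rw [div_eq_iff n5]; linear_combination -p5 / 2
  rw [p1', p5', ← prod, mul_div_assoc, div_self (mul_ne_zero n1 n10)]
  linear_combination main / 4

lemma rel_phi {q : ℂ} (hq : ‖q‖ < 1) (hq0 : q ≠ 0) :
    (qpoch q q ^ 2 / qpoch (q ^ 2) (q ^ 2)) ^ 2 -
      (qpoch (q ^ 5) (q ^ 5) ^ 2 / qpoch (q ^ 10) (q ^ 10)) ^ 2 =
    -4 * q * (qpoch q q * qpoch (q ^ 10) (q ^ 10) ^ 3 /
      (qpoch (q ^ 2) (q ^ 2) * qpoch (q ^ 5) (q ^ 5))) := by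
  have hq5 : ‖q ^ 5‖ < 1 := norm_pow_lt_one hq (by norm_num)
  have hq50 : q ^ 5 ≠ 0 := pow_ne_zero _ hq0
  have hq2 : ‖q ^ 2‖ < 1 := norm_pow_lt_one hq (by norm_num)
  have hq10 : ‖q ^ 10‖ < 1 := norm_pow_lt_one hq (by norm_num)
  have n2 := F_ne_zero hq2
  have n5 := F_ne_zero hq5
  have n10 := F_ne_zero hq10
  have p1 := theta_phi hq hq0
  have p5 := theta_phi hq5 hq50
  have e210 : (q ^ 5) ^ 2 = q ^ 10 := by ring
  have e25 : (q ^ 2) ^ 5 = q ^ 10 := by ring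
  rw [e210] at p5
  have hm : (-1 : ℂ) ≠ 0 := by norm_num
  have hd := theta_diss2 hq hq0 hm hm
  rw [Fin.sum_univ_five] at hd
  simp only [Fin.val_zero, Fin.val_one, Fin.val_two, Fin.isValue] at hd
  have v3 : ((3 : Fin 5) : ℕ) = 3 := rfl
  have v4 : ((4 : Fin 5) : ℕ) = 4 := rfl
  rw [v3, v4] at hd
  norm_num at hd
  have im : ∀ x : ℂ, thetaT (q ^ 5) (-x⁻¹) = thetaT (q ^ 5) (-x) := fun x => by
    rw [← inv_neg]; exact thetaT_inv _ _
  have j2 := thetaT_shift hq50 (neg_ne_zero.2 (inv_ne_zero (pow_ne_zero 2 hq0)))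
  have k2 : (q ^ 5) ^ 2 * -(q ^ 2)⁻¹ = -q ^ 8 := by field_simp
  have l2 : q ^ 5 * -(q ^ 2)⁻¹ = -q ^ 3 := by field_simp
  rw [k2, l2, im] at j2
  rw [im, im, im] at hd
  have main : thetaT q (-1) ^ 2 = thetaT (q ^ 5) (-1) ^ 2 -
      4 * q * (thetaT (q ^ 5) (-q ^ 2) * thetaT (q ^ 5) (-q ^ 4)) := by
    linear_combination hd + 2 * q * thetaT (q ^ 5) (-q ^ 4) * j2
  have t2 := jtp hq5 hq50 (neg_ne_zero.2 (pow_ne_zero 2 hq0))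
  have t4 := jtp hq5 hq50 (neg_ne_zero.2 (pow_ne_zero 4 hq0))
  have o1 := odd_poch hq
  have o5 := odd_poch hq5
  rw [split5 q hq2] at o1
  have b1 : -(-q ^ 2 * q ^ 5) = q * (q ^ 2) ^ 3 := by ring
  have b2 : -(q ^ 5 / -q ^ 2) = q * q ^ 2 := by field_simp
  have b3 : -(-q ^ 4 * q ^ 5) = q * (q ^ 2) ^ 4 := by ring
  have b4 : -(q ^ 5 / -q ^ 4) = q := by field_simp
  have b5 : q * (q ^ 2) ^ 2 = q ^ 5 := by ring
  rw [b1, b2, e210] at t2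
  rw [b3, b4, e210] at t4
  rw [b5, e25] at o1
  rw [e210] at o5
  have prod : thetaT (q ^ 5) (-q ^ 2) * thetaT (q ^ 5) (-q ^ 4) *
      (qpoch (q ^ 2) (q ^ 2) * qpoch (q ^ 5) (q ^ 5)) =
      qpoch q q * qpoch (q ^ 10) (q ^ 10) ^ 3 := by
    rw [t2, t4, ← o1, ← o5]; ring
  rw [← p1, ← p5, ← prod, mul_div_assoc, div_self n2, mul_div_assoc, div_self n10,
    mul_div_assoc, div_self (mul_ne_zero n2 n5)]
  linear_combination main

/-- The key eta-quotient identity of level 10. -/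
lemma key_star {q : ℂ} (hq : ‖q‖ < 1) (hq0 : q ≠ 0) :
    20 * q ^ 3 * (qpoch (q ^ 10) (q ^ 10) ^ 10 * qpoch q q /
      (qpoch (q ^ 5) (q ^ 5) ^ 5 * qpoch (q ^ 2) (q ^ 2) ^ 2)) =
    5 * (q * qpoch (q ^ 5) (q ^ 5) ^ 5 / qpoch q q) -
      15 * (q ^ 2 * qpoch (q ^ 10) (q ^ 10) ^ 5 / qpoch (q ^ 2) (q ^ 2)) +
      qpoch q q ^ 5 / qpoch (q ^ 5) (q ^ 5) -
      qpoch (q ^ 2) (q ^ 2) ^ 5 / qpoch (q ^ 10) (q ^ 10) := by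
  have n1 := F_ne_zero hq
  have n2 := F_ne_zero (norm_pow_lt_one hq (n := 2) (by norm_num))
  have n5 := F_ne_zero (norm_pow_lt_one hq (n := 5) (by norm_num))
  have n10 := F_ne_zero (norm_pow_lt_one hq (n := 10) (by norm_num))
  have r1 := rel_psi hq hq0
  have r2 := rel_phi hq hq0
  generalize qpoch q q = f1 at *
  generalize qpoch (q ^ 2) (q ^ 2) = f2 at *
  generalize qpoch (q ^ 5) (q ^ 5) = f5 at *
  generalize qpoch (q ^ 10) (q ^ 10) = f10 at *
  obtain ⟨A, hA⟩ : ∃ A, A = f1 * f10 / (f2 * f5) := ⟨_, rfl⟩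
  obtain ⟨B, hB⟩ : ∃ B, B = f2 / f10 := ⟨_, rfl⟩
  obtain ⟨D, hD⟩ : ∃ D, D = f5 ^ 4 / f10 ^ 4 := ⟨_, rfl⟩
  have nA : A ≠ 0 := by rw [hA]; positivity
  have nB : B ≠ 0 := by rw [hB]; positivity
  have nD : D ≠ 0 := by rw [hD]; positivity
  have h1 : B ^ 2 = A * D + q * A ^ 2 := by
    rw [hA, hB, hD]
    field_simp at r1 ⊢
    linear_combination r1
  have h2 : A ^ 4 * B ^ 2 * D = D - 4 * q * A := by
    rw [hA, hB, hD]
    field_simp at r2 ⊢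
    linear_combination r2
  have e1 : f10 ^ 10 * f1 / (f5 ^ 5 * f2 ^ 2) = f10 ^ 4 * (A / (B * D)) := by
    rw [hA, hB, hD]; field_simp
  have e2 : q * f5 ^ 5 / f1 = f10 ^ 4 * (q * D / (A * B)) := by
    rw [hA, hB, hD]; field_simp
  have e3 : q ^ 2 * f10 ^ 5 / f2 = f10 ^ 4 * (q ^ 2 / B) := by
    rw [hB]; field_simp
  have e4 : f1 ^ 5 / f5 = f10 ^ 4 * (A ^ 5 * B ^ 5 * D) := by
    rw [hA, hB, hD]; field_simp
  have e5 : f2 ^ 5 / f10 = f10 ^ 4 * B ^ 5 := by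
    rw [hB]; field_simp
  rw [e1, e2, e3, e4, e5]
  have pol : 20 * q ^ 3 * A ^ 2 = 5 * q * D ^ 2 - 15 * q ^ 2 * A * D + A ^ 6 * B ^ 6 * D ^ 2
      - A * B ^ 6 * D := by
    linear_combination (-A ^ 2 * B ^ 4 * D + 5 * q * (D + q * A)) * h2 +
      (A * B ^ 4 * D + 5 * q * A ^ 3 * B ^ 2 * D) * h1
  field_simp
  linear_combination pol

lemma zpow_pow_nat (s : ℂ) (k : ℕ) (n : ℤ) : (s ^ k) ^ n = s ^ ((k : ℤ) * n) := by
  rw [zpow_mul, zpow_natCast]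

/-- Euler's pentagonal number theorem as a theta function. -/
lemma euler_theta {s : ℂ} (hs1 : ‖s‖ < 1) (hs : s ≠ 0) :
    thetaT (s ^ 3) (-s⁻¹) = qpoch (s ^ 2) (s ^ 2) := by
  have h3 : ‖s ^ 3‖ < 1 := norm_pow_lt_one hs1 (by norm_num)
  have hq : ‖s ^ 2‖ < 1 := norm_pow_lt_one hs1 (by norm_num)
  rw [jtp h3 (pow_ne_zero 3 hs) (neg_ne_zero.2 (inv_ne_zero hs)),
    qpoch_split (s ^ 2) hq (m := 3) (by norm_num)]
  simp only [Finset.prod_range_succ, Finset.prod_range_zero, pow_zero, mul_one, one_mul, pow_one]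
  have e1 : (s ^ 3) ^ 2 = (s ^ 2) ^ 3 := by ring
  have e2 : -(-s⁻¹ * s ^ 3) = s ^ 2 := by field_simp
  have e3 : -(s ^ 3 / -s⁻¹) = s ^ 2 * s ^ 2 := by field_simp
  have e4 : s ^ 2 * (s ^ 2) ^ 2 = (s ^ 2) ^ 3 := by ring
  rw [e1, e2, e3, e4]; ring

lemma F_diss {t : ℂ} (ht1 : ‖t‖ < 1) (ht : t ≠ 0) : ∃ u w : ℂ, ∀ s : ℂ, s ^ 5 = t →
    qpoch (s ^ 2) (s ^ 2) = u - s ^ 2 * qpoch (s ^ 50) (s ^ 50) - s ^ 4 * w := by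
  refine ⟨thetaT (t ^ 15) (-t⁻¹) + t ^ 2 * thetaT (t ^ 15) (-t ^ 11),
    thetaT (t ^ 15) (-(t ^ 7)⁻¹) - t ^ 2 * thetaT (t ^ 15) (-(t ^ 13)⁻¹), ?_⟩
  rintro s rfl
  have hs : s ≠ 0 := fun h => ht (by rw [h]; simp)
  have hs1 : ‖s‖ < 1 := by
    by_contra h
    push Not at h
    have : 1 ≤ ‖s ^ 5‖ := by rw [norm_pow]; exact one_le_pow₀ h
    linarith
  have h3 : ‖s ^ 3‖ < 1 := norm_pow_lt_one hs1 (by norm_num)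
  have h25 : ‖s ^ 25‖ < 1 := norm_pow_lt_one hs1 (by norm_num)
  have hd := theta_diss h3 (pow_ne_zero 3 hs) (neg_ne_zero.2 (inv_ne_zero hs))
  rw [euler_theta hs1 hs, Fin.sum_univ_five] at hd
  simp only [Fin.val_zero, Fin.val_one, Fin.val_two, Fin.isValue] at hd
  have v3 : ((3 : Fin 5) : ℕ) = 3 := rfl
  have v4 : ((4 : Fin 5) : ℕ) = 4 := rfl
  rw [v3, v4] at hd
  have hm := euler_theta h25 (pow_ne_zero 25 hs)
  rw [← inv_neg, thetaT_inv] at hm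
  norm_num at hd
  have a0 : (s ^ 3) ^ 25 = (s ^ 5) ^ 15 := by ring
  have a1 : ((s ^ 3) ^ 20)⁻¹ * (-s⁻¹) ^ 5 = -((s ^ 5) ^ 13)⁻¹ := by field_simp
  have a2 : ((s ^ 3) ^ 10)⁻¹ * (-s⁻¹) ^ 5 = -((s ^ 5) ^ 7)⁻¹ := by field_simp
  have a3 : (-s⁻¹) ^ 5 = -(s ^ 5)⁻¹ := by field_simp
  have a4 : (s ^ 3) ^ 10 * (-s⁻¹) ^ 5 = -s ^ 25 := by field_simp
  have a5 : (s ^ 3) ^ 20 * (-s⁻¹) ^ 5 = -(s ^ 5) ^ 11 := by field_simp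
  have a6 : s ^ 3 * s⁻¹ = s ^ 2 := by field_simp
  have a7 : (s ^ 3) ^ 4 * (s ^ 2)⁻¹ = (s ^ 5) ^ 2 := by field_simp
  have m1 : (s ^ 25) ^ 3 = (s ^ 5) ^ 15 := by ring
  have m2 : (s ^ 25) ^ 2 = s ^ 50 := by ring
  rw [m1, m2] at hm
  rw [a1, a2, a4, a5, a3, a6, a7, a0, hm] at hd
  rw [hd]
  ring

lemma cube_term {s : ℂ} (hs : s ≠ 0) (m ρ : ℤ) :
    ((5 * m + ρ : ℤ) : ℂ) * (s ^ ((5 * m + ρ) ^ 2) * (-s⁻¹) ^ (5 * m + ρ)) =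
    s ^ (ρ ^ 2 - ρ) * ((-1) ^ ρ * (((5 * m + ρ : ℤ) : ℂ) *
      (((s ^ 5) ^ 5) ^ (m ^ 2) * (-(s ^ 5) ^ (2 * ρ - 1)) ^ m))) := by
  have e1 : (-s⁻¹) = (-1) * s⁻¹ := by ring
  have e2 : (-(s ^ 5) ^ (2 * ρ - 1)) = (-1) * (s ^ 5) ^ (2 * ρ - 1) := by ring
  have e3 : ((-1 : ℂ)) ^ (5 * m + ρ) = (-1) ^ m * (-1) ^ ρ := by
    rw [zpow_add₀ (by norm_num), zpow_mul]; norm_num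
  have e4 : s ^ ((5 * m + ρ) ^ 2) * s ^ (-(5 * m + ρ)) =
      s ^ (ρ ^ 2 - ρ) * s ^ (5 * (5 * m ^ 2)) * s ^ (5 * ((2 * ρ - 1) * m)) := by
    simp only [← zpow_add₀ hs]; congr 1; ring
  rw [e1, e2, mul_zpow, mul_zpow, e3, inv_zpow', ← zpow_mul, zpow_pow_nat (s ^ 5), zpow_pow_nat s,
    zpow_pow_nat s]
  push_cast
  linear_combination (5 * (m : ℂ) + ρ) * (-1) ^ m * (-1) ^ ρ * e4

lemma cube_diss {t : ℂ} (ht1 : ‖t‖ < 1) (ht : t ≠ 0) : ∃ a b : ℂ, ∀ s : ℂ, s ^ 5 = t →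
    qpoch (s ^ 2) (s ^ 2) ^ 3 = a + s ^ 2 * b + 5 * s ^ 6 * qpoch (s ^ 50) (s ^ 50) ^ 3 := by
  set C : ℤ → ℂ := fun ρ => ∑' m : ℤ, ((-1 : ℂ) ^ ρ * (((5 * m + ρ : ℤ) : ℂ) *
      ((t ^ 5) ^ (m ^ 2) * (-t ^ (2 * ρ - 1)) ^ m))) with hC
  refine ⟨-C 0 - C 1, -C (-1) - C 2, ?_⟩
  rintro s rfl
  have hs : s ≠ 0 := fun h => ht (by rw [h]; simp)
  have hs1 : ‖s‖ < 1 := by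
    by_contra h
    push Not at h
    have : 1 ≤ ‖s ^ 5‖ := by rw [norm_pow]; exact one_le_pow₀ h
    linarith
  have h25 : ‖s ^ 25‖ < 1 := norm_pow_lt_one hs1 (by norm_num)
  have n25 : s ^ 25 ≠ 0 := pow_ne_zero 25 hs
  have i25 : -(s ^ 25)⁻¹ ≠ 0 := neg_ne_zero.2 (inv_ne_zero n25)
  have hw : -s⁻¹ ≠ 0 := neg_ne_zero.2 (inv_ne_zero hs)
  have hsum := (theta_summable_pow hs1 hs hw 1).of_norm
  simp only [pow_one] at hsum
  have h1 := jacobi_cube hs1 hs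
  have h2 : Summable fun x : Fin 5 × ℤ => ((dissEquiv x : ℤ) : ℂ) *
      (s ^ ((dissEquiv x) ^ 2) * (-s⁻¹) ^ (dissEquiv x)) :=
    (dissEquiv.summable_iff (f := fun n : ℤ => (n : ℂ) * (s ^ (n ^ 2) * (-s⁻¹) ^ n))).2 hsum
  rw [← dissEquiv.tsum_eq, Summable.tsum_prod h2, tsum_fintype] at h1
  have h3 : ∀ r : Fin 5, ∑' m : ℤ, ((dissEquiv (r, m) : ℤ) : ℂ) *
      (s ^ ((dissEquiv (r, m)) ^ 2) * (-s⁻¹) ^ (dissEquiv (r, m))) =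
      s ^ ((((r : ℕ) : ℤ) - 2) ^ 2 - (((r : ℕ) : ℤ) - 2)) * C (((r : ℕ) : ℤ) - 2) := by
    intro r
    rw [hC]
    simp only
    rw [← tsum_mul_left]
    refine tsum_congr fun m => ?_
    have e : dissEquiv (r, m) = 5 * m + (((r : ℕ) : ℤ) - 2) := by
      simp only [dissEquiv, Equiv.coe_fn_mk]; omega
    rw [e]
    exact cube_term hs m _
  rw [Finset.sum_congr rfl fun r _ => h3 r, Fin.sum_univ_five] at h1
  simp only [Fin.val_zero, Fin.val_one, Fin.val_two, Fin.isValue] at h1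
  have v3 : ((3 : Fin 5) : ℕ) = 3 := rfl
  have v4 : ((4 : Fin 5) : ℕ) = 4 := rfl
  rw [v3, v4] at h1
  have hc : C (-2) = -5 * qpoch (s ^ 50) (s ^ 50) ^ 3 := by
    have j := jacobi_cube h25 n25
    have hz : thetaT (s ^ 25) (-(s ^ 25)⁻¹) = 0 := by
      rw [jtp h25 n25 i25]
      have : -(-(s ^ 25)⁻¹ * s ^ 25) = 1 := by field_simp
      rw [this, qpoch_head 1 (norm_pow_lt_one h25 two_ne_zero)]; ring
    have s1 := (theta_summable_pow h25 n25 i25 1).of_norm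
    have s0 := (theta_summable_norm h25 n25 i25).of_norm
    simp only [pow_one] at s1
    have e50 : (s ^ 25) ^ 2 = s ^ 50 := by ring
    rw [e50] at j
    have : C (-2) = 5 * ∑' n : ℤ, (n : ℂ) * ((s ^ 25) ^ (n ^ 2) * (-(s ^ 25)⁻¹) ^ n)
        - 2 * thetaT (s ^ 25) (-(s ^ 25)⁻¹) := by
      rw [thetaT, ← tsum_mul_left, ← tsum_mul_left, ← (s1.mul_left 5).tsum_sub (s0.mul_left 2), hC]
      refine tsum_congr fun m => ?_
      have e25 : (s ^ 5) ^ 5 = s ^ 25 := by ring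
      have e3 : (s ^ 5) ^ (2 * (-2 : ℤ) - 1) = (s ^ 25)⁻¹ := by
        rw [zpow_pow_nat]; norm_num
      rw [e25, e3]
      push_cast
      norm_num
      ring
    rw [this, j, hz]; ring
  norm_num at h1
  rw [hc] at h1
  linear_combination h1

lemma filter5 {z : ℂ} (hz : IsPrimitiveRoot z 5) {a0 a1 a2 a3 a4 : ℂ}
    (h : ∀ y : ℂ, y ^ 5 = 1 → a0 + a1 * y + a2 * y ^ 2 + a3 * y ^ 3 + a4 * y ^ 4 = 0) :
    a0 = 0 ∧ a1 = 0 ∧ a2 = 0 ∧ a3 = 0 ∧ a4 = 0 := by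
  have hz5 : z ^ 5 = 1 := hz.pow_eq_one
  have hy : ∀ k : ℕ, (z ^ k) ^ 5 = 1 := fun k => by rw [← pow_mul, mul_comm, pow_mul, hz5, one_pow]
  have hP : 1 + z + z ^ 2 + z ^ 3 + z ^ 4 = 0 := by
    have := hz.geom_sum_eq_zero (by norm_num)
    simpa [Finset.sum_range_succ] using this
  have h0 := h (z ^ 0) (hy 0)
  have h1 := h (z ^ 1) (hy 1)
  have h2 := h (z ^ 2) (hy 2)
  have h3 := h (z ^ 3) (hy 3)
  have h4 := h (z ^ 4) (hy 4)
  have k0 : 5 * a0 = 0 := by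
    linear_combination z ^ 0 * h0 + z ^ 0 * h1 + z ^ 0 * h2 + z ^ 0 * h3 + z ^ 0 * h4 +
      (a1 * ((-1) * z ^ 0) +
        a2 * ((-1) * z ^ 0 + z ^ 1 + (-1) * z ^ 2 + z ^ 3 + (-1) * z ^ 4) +
        a3 * ((-1) * z ^ 0 + z ^ 1 + (-1) * z ^ 3 + z ^ 4 + (-1) * z ^ 5 + z ^ 7 + (-1) * z ^ 8) +
        a4 * ((-1) * z ^ 0 + z ^ 1 + (-1) * z ^ 4 + z ^ 6 + (-1) * z ^ 8 + z ^ 11 + (-1) * z ^ 12)) * hP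
  have k1 : 5 * a1 = 0 := by
    linear_combination z ^ 0 * h0 + z ^ 4 * h1 + z ^ 8 * h2 + z ^ 12 * h3 + z ^ 16 * h4 +
      (a0 * ((-1) * z ^ 0 + z ^ 1 + (-1) * z ^ 4 + z ^ 6 + (-1) * z ^ 8 + z ^ 11 + (-1) * z ^ 12) +
        a1 * ((4) * z ^ 0 + (-4) * z ^ 1 + (3) * z ^ 5 + (-3) * z ^ 6 + (2) * z ^ 10 + (-2) * z ^ 11 + z ^ 15 + (-1) * z ^ 16) +
        a2 * ((-1) * z ^ 0 + z ^ 1 + (-1) * z ^ 5 + z ^ 7 + (-1) * z ^ 10 + z ^ 13 + (-1) * z ^ 15 + z ^ 19 + (-1) * z ^ 20) +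
        a3 * ((-1) * z ^ 0 + z ^ 1 + (-1) * z ^ 5 + z ^ 6 + (-1) * z ^ 7 + z ^ 8 + (-1) * z ^ 10 + z ^ 11 + (-1) * z ^ 12 + z ^ 13 + (-1) * z ^ 14 + z ^ 16 + (-1) * z ^ 17 + z ^ 18 + (-1) * z ^ 19 + z ^ 23 + (-1) * z ^ 24) +
        a4 * ((-1) * z ^ 0 + z ^ 1 + (-1) * z ^ 5 + z ^ 6 + (-1) * z ^ 8 + z ^ 9 + (-1) * z ^ 10 + z ^ 11 + (-1) * z ^ 13 + z ^ 14 + (-1) * z ^ 15 + z ^ 17 + (-1) * z ^ 18 + z ^ 19 + (-1) * z ^ 20 + z ^ 22 + (-1) * z ^ 23 + z ^ 27 + (-1) * z ^ 28)) * hP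
  have k2 : 5 * a2 = 0 := by
    linear_combination z ^ 0 * h0 + z ^ 3 * h1 + z ^ 6 * h2 + z ^ 9 * h3 + z ^ 12 * h4 +
      (a0 * ((-1) * z ^ 0 + z ^ 1 + (-1) * z ^ 3 + z ^ 4 + (-1) * z ^ 5 + z ^ 7 + (-1) * z ^ 8) +
        a1 * ((-1) * z ^ 0 + z ^ 1 + (-1) * z ^ 4 + z ^ 6 + (-1) * z ^ 8 + z ^ 11 + (-1) * z ^ 12) +
        a2 * ((4) * z ^ 0 + (-4) * z ^ 1 + (3) * z ^ 5 + (-3) * z ^ 6 + (2) * z ^ 10 + (-2) * z ^ 11 + z ^ 15 + (-1) * z ^ 16) +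
        a3 * ((-1) * z ^ 0 + z ^ 1 + (-1) * z ^ 5 + z ^ 7 + (-1) * z ^ 10 + z ^ 13 + (-1) * z ^ 15 + z ^ 19 + (-1) * z ^ 20) +
        a4 * ((-1) * z ^ 0 + z ^ 1 + (-1) * z ^ 5 + z ^ 6 + (-1) * z ^ 7 + z ^ 8 + (-1) * z ^ 10 + z ^ 11 + (-1) * z ^ 12 + z ^ 13 + (-1) * z ^ 14 + z ^ 16 + (-1) * z ^ 17 + z ^ 18 + (-1) * z ^ 19 + z ^ 23 + (-1) * z ^ 24)) * hP
  have k3 : 5 * a3 = 0 := by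
    linear_combination z ^ 0 * h0 + z ^ 2 * h1 + z ^ 4 * h2 + z ^ 6 * h3 + z ^ 8 * h4 +
      (a0 * ((-1) * z ^ 0 + z ^ 1 + (-1) * z ^ 2 + z ^ 3 + (-1) * z ^ 4) +
        a1 * ((-1) * z ^ 0 + z ^ 1 + (-1) * z ^ 3 + z ^ 4 + (-1) * z ^ 5 + z ^ 7 + (-1) * z ^ 8) +
        a2 * ((-1) * z ^ 0 + z ^ 1 + (-1) * z ^ 4 + z ^ 6 + (-1) * z ^ 8 + z ^ 11 + (-1) * z ^ 12) +
        a3 * ((4) * z ^ 0 + (-4) * z ^ 1 + (3) * z ^ 5 + (-3) * z ^ 6 + (2) * z ^ 10 + (-2) * z ^ 11 + z ^ 15 + (-1) * z ^ 16) +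
        a4 * ((-1) * z ^ 0 + z ^ 1 + (-1) * z ^ 5 + z ^ 7 + (-1) * z ^ 10 + z ^ 13 + (-1) * z ^ 15 + z ^ 19 + (-1) * z ^ 20)) * hP
  have k4 : 5 * a4 = 0 := by
    linear_combination z ^ 0 * h0 + z ^ 1 * h1 + z ^ 2 * h2 + z ^ 3 * h3 + z ^ 4 * h4 +
      (a0 * ((-1) * z ^ 0) +
        a1 * ((-1) * z ^ 0 + z ^ 1 + (-1) * z ^ 2 + z ^ 3 + (-1) * z ^ 4) +
        a2 * ((-1) * z ^ 0 + z ^ 1 + (-1) * z ^ 3 + z ^ 4 + (-1) * z ^ 5 + z ^ 7 + (-1) * z ^ 8) +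
        a3 * ((-1) * z ^ 0 + z ^ 1 + (-1) * z ^ 4 + z ^ 6 + (-1) * z ^ 8 + z ^ 11 + (-1) * z ^ 12) +
        a4 * ((4) * z ^ 0 + (-4) * z ^ 1 + (3) * z ^ 5 + (-3) * z ^ 6 + (2) * z ^ 10 + (-2) * z ^ 11 + z ^ 15 + (-1) * z ^ 16)) * hP
  refine ⟨?_, ?_, ?_, ?_, ?_⟩
  · linear_combination k0 / 5
  · linear_combination k1 / 5
  · linear_combination k2 / 5
  · linear_combination k3 / 5
  · linear_combination k4 / 5

lemma uvw {q z : ℂ} (hq : ‖q‖ < 1) (hq0 : q ≠ 0) (hz : IsPrimitiveRoot z 5) :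
    ∃ u v w : ℂ, v = q * qpoch (q ^ 25) (q ^ 25) ∧ v ≠ 0 ∧ v ^ 2 = u * w ∧
      ∀ y : ℂ, y ^ 5 = 1 → qpoch (y * q) (y * q) = u - y * v - y ^ 2 * w := by
  obtain ⟨s, hsq, hs1, hs⟩ := exists_sqrt hq hq0
  obtain ⟨u, w, hF⟩ := F_diss (norm_pow_lt_one hs1 (n := 5) (by norm_num)) (pow_ne_zero 5 hs)
  obtain ⟨a, b, hC⟩ := cube_diss (norm_pow_lt_one hs1 (n := 5) (by norm_num)) (pow_ne_zero 5 hs)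
  have nv : q * qpoch (q ^ 25) (q ^ 25) ≠ 0 :=
    mul_ne_zero hq0 (F_ne_zero (norm_pow_lt_one hq (by norm_num)))
  have e5 : ∀ y : ℂ, y ^ 5 = 1 → (y ^ 3 * s) ^ 5 = s ^ 5 := fun y hy => by
    linear_combination s ^ 5 * (y ^ 10 + y ^ 5 + 1) * hy
  have e2 : ∀ y : ℂ, y ^ 5 = 1 → (y ^ 3 * s) ^ 2 = y * q := fun y hy => by
    rw [← hsq]; linear_combination s ^ 2 * y * hy
  have e50 : ∀ y : ℂ, y ^ 5 = 1 → (y ^ 3 * s) ^ 50 = q ^ 25 := fun y hy => by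
    have : (y ^ 3 * s) ^ 50 = (y ^ 5) ^ 30 * (s ^ 2) ^ 25 := by ring
    rw [this, hy, hsq, one_pow, one_mul]
  have hF' : ∀ y : ℂ, y ^ 5 = 1 → qpoch (y * q) (y * q) =
      u - y * (q * qpoch (q ^ 25) (q ^ 25)) - y ^ 2 * (q ^ 2 * w) := fun y hy => by
    have := hF _ (e5 y hy)
    have e4 : (y ^ 3 * s) ^ 4 = (y * q) ^ 2 := by rw [← e2 y hy]; ring
    rw [e4, e50 y hy, e2 y hy] at this
    rw [this]; ring
  have hC' : ∀ y : ℂ, y ^ 5 = 1 → qpoch (y * q) (y * q) ^ 3 =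
      a + y * (q * b) + 5 * y ^ 3 * (q * qpoch (q ^ 25) (q ^ 25)) ^ 3 := fun y hy => by
    have := hC _ (e5 y hy)
    have e6 : (y ^ 3 * s) ^ 6 = (y * q) ^ 3 := by rw [← e2 y hy]; ring
    rw [e6, e50 y hy, e2 y hy] at this
    rw [this]; ring
  refine ⟨u, q * qpoch (q ^ 25) (q ^ 25), q ^ 2 * w, rfl, nv, ?_, hF'⟩
  generalize q * qpoch (q ^ 25) (q ^ 25) = v at *
  generalize q ^ 2 * w = w at *
  have hf := filter5 hz (a0 := u ^ 3 - 3 * v * w ^ 2 - a) (a1 := -3 * u ^ 2 * v - w ^ 3 - q * b)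
    (a2 := -3 * u ^ 2 * w + 3 * u * v ^ 2) (a3 := 6 * u * v * w - v ^ 3 - 5 * v ^ 3)
    (a4 := 3 * u * w ^ 2 - 3 * v ^ 2 * w) (fun y hy => by
      have h1 := hC' y hy
      rw [hF' y hy] at h1
      linear_combination h1 + (3 * v * w ^ 2 + w ^ 3 * y) * hy)
  have h3 := hf.2.2.2.1
  apply mul_left_cancel₀ nv
  linear_combination -h3 / 6

lemma norm_poly {z u v w : ℂ} (hP : 1 + z + z ^ 2 + z ^ 3 + z ^ 4 = 0) (hv : v ^ 2 = u * w) :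
    (u - v - w) * (u - z * v - z ^ 2 * w) * (u - z ^ 2 * v - (z ^ 2) ^ 2 * w) *
      (u - z ^ 3 * v - (z ^ 3) ^ 2 * w) * (u - z ^ 4 * v - (z ^ 4) ^ 2 * w) =
      u ^ 5 - 11 * v ^ 5 - w ^ 5 := by
  linear_combination (w ^ 5 + v ^ 5 + 5 * u * v ^ 3 * w + 5 * u ^ 2 * v * w ^ 2 - u ^ 4 * w - u ^ 4 *
      v - z * w ^ 5 - z * v ^ 5 - 5 * z * u * v ^ 3 * w - 5 * z * u ^ 2 * v * w ^ 2 +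
      z * u ^ 3 * v * w + z * u ^ 3 * v ^ 2 + z * u ^ 4 * w + z ^ 2 * u ^ 3 * w ^ 2 +
      z ^ 2 * u ^ 3 * v * w - z ^ 2 * u ^ 4 * w - z ^ 3 * u ^ 2 * v ^ 2 * w - z ^ 3 *
      u ^ 2 * v ^ 3 - z ^ 3 * u ^ 3 * w ^ 2 - z ^ 3 * u ^ 3 * v * w + z ^ 3 * u ^ 3 *
      v ^ 2 + z ^ 3 * u ^ 4 * w - z ^ 4 * u ^ 2 * v * w ^ 2 - z ^ 4 * u ^ 2 * v ^ 2 *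
      w + z ^ 4 * u ^ 3 * w ^ 2 + 2 * z ^ 4 * u ^ 3 * v * w - z ^ 4 * u ^ 4 * w + z ^
      5 * w ^ 5 + z ^ 5 * v ^ 5 + 5 * z ^ 5 * u * v ^ 3 * w + 4 * z ^ 5 * u ^ 2 * v *
      w ^ 2 - 2 * z ^ 5 * u ^ 2 * v ^ 2 * w - z ^ 5 * u ^ 2 * v ^ 3 - z ^ 5 * u ^ 3 *
      w ^ 2 - z ^ 5 * u ^ 3 * v * w - z ^ 6 * w ^ 5 - z ^ 6 * v ^ 5 - 4 * z ^ 6 * u *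
      v ^ 3 * w + z ^ 6 * u * v ^ 4 - z ^ 6 * u ^ 2 * w ^ 3 - 5 * z ^ 6 * u ^ 2 * v *
      w ^ 2 + 2 * z ^ 6 * u ^ 2 * v ^ 2 * w + 2 * z ^ 6 * u ^ 3 * w ^ 2 + z ^ 6 * u ^
      3 * v * w + z ^ 7 * u * v ^ 2 * w ^ 2 + z ^ 7 * u * v ^ 3 * w + z ^ 7 * u ^ 2 *
      w ^ 3 - 2 * z ^ 7 * u ^ 2 * v ^ 2 * w - z ^ 7 * u ^ 3 * w ^ 2 + z ^ 7 * u ^ 3 *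
      v * w + z ^ 8 * u * v ^ 2 * w ^ 2 + z ^ 8 * u * v ^ 3 * w - z ^ 8 * u ^ 2 * w ^
      3 - z ^ 8 * u ^ 2 * v * w ^ 2 - z ^ 8 * u ^ 2 * v ^ 2 * w + z ^ 8 * u ^ 3 * w ^
      2 + z ^ 9 * u * v * w ^ 3 + 2 * z ^ 9 * u * v ^ 2 * w ^ 2 + z ^ 9 * u * v ^ 3 *
      w + z ^ 9 * u ^ 2 * w ^ 3 - z ^ 9 * u ^ 2 * v ^ 2 * w - z ^ 9 * u ^ 3 * w ^ 2 +
      z ^ 10 * w ^ 5 - z ^ 10 * v ^ 4 * w + z ^ 10 * u * v * w ^ 3 - 2 * z ^ 10 * u *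
      v ^ 2 * w ^ 2 + z ^ 10 * u * v ^ 3 * w - 2 * z ^ 10 * u ^ 2 * w ^ 3 + z ^ 10 * u
      ^ 3 * w ^ 2 - z ^ 11 * w ^ 5 - z ^ 11 * v ^ 3 * w ^ 2 - z ^ 11 * u * v * w ^ 3 +
      2 * z ^ 11 * u * v ^ 2 * w ^ 2 + z ^ 11 * u ^ 2 * w ^ 3 - z ^ 11 * u ^ 2 * v * w
      ^ 2 + z ^ 12 * u * w ^ 4 + 2 * z ^ 12 * u * v * w ^ 3 + z ^ 12 * u * v ^ 2 * w ^
      2 - z ^ 12 * u ^ 2 * w ^ 3 - z ^ 12 * u ^ 2 * v * w ^ 2 - z ^ 13 * v ^ 2 * w ^ 3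
      - z ^ 13 * v ^ 3 * w ^ 2 - z ^ 13 * u * w ^ 4 - z ^ 13 * u * v * w ^ 3 + z ^ 13
      * u * v ^ 2 * w ^ 2 + z ^ 13 * u ^ 2 * w ^ 3 + z ^ 14 * u * w ^ 4 + z ^ 14 * u *
      v * w ^ 3 - z ^ 14 * u ^ 2 * w ^ 3 + z ^ 15 * w ^ 5 - z ^ 15 * v ^ 2 * w ^ 3 - z
      ^ 15 * u * w ^ 4 + z ^ 15 * u * v * w ^ 3 - z ^ 16 * w ^ 5 - z ^ 16 * v * w ^ 4
      + z ^ 16 * u * w ^ 4) * hP + (10 * v ^ 3 + 5 * u * v * w) * hv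

/-- The quartic cofactor of the norm. -/
def quart (u v w : ℂ) : ℂ := u ^ 4 + u ^ 3 * v + 2 * u ^ 2 * v ^ 2 + 3 * u * v ^ 3 + 5 * v ^ 4 -
  3 * v ^ 3 * w + 2 * v ^ 2 * w ^ 2 - v * w ^ 3 + w ^ 4

lemma quart_mul {y u v w : ℂ} (hy : y ^ 5 = 1) (hv : v ^ 2 = u * w) :
    (u - y * v - y ^ 2 * w) * quart u (y * v) (y ^ 2 * w) = u ^ 5 - 11 * v ^ 5 - w ^ 5 := by
  unfold quart
  linear_combination (11 * v ^ 3 + 11 * u * v * w + y ^ 2 * u ^ 3 + y ^ 3 * u ^ 2 * v +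
      2 * y ^ 4 * u * v ^ 2 - 5 * y ^ 5 * v ^ 3 - 11 * y ^ 5 * u * v * w - 2 * y ^ 6 * v ^ 2 * w +
      y ^ 7 * v * w ^ 2 - y ^ 8 * w ^ 3) * hv +
    (-w ^ 5 - 11 * u ^ 2 * v * w ^ 2 - y ^ 5 * w ^ 5) * hy

lemma KE_diss {q z : ℂ} (hq : ‖q‖ < 1) (hq0 : q ≠ 0) (hz : IsPrimitiveRoot z 5) :
    ∃ a0 a2 a3 b0 b1 b4 : ℂ, ∀ y : ℂ, y ^ 5 = 1 →
      (qpoch (y * q) (y * q) ^ 5 / qpoch (q ^ 5) (q ^ 5) +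
        5 * (y * q * qpoch (q ^ 5) (q ^ 5) ^ 5 / qpoch (y * q) (y * q)) =
        a0 + a2 * y ^ 2 + a3 * y ^ 3) ∧
      (qpoch (y * q) (y * q) ^ 5 / qpoch (q ^ 5) (q ^ 5) -
        5 * (y * q * qpoch (q ^ 5) (q ^ 5) ^ 5 / qpoch (y * q) (y * q)) =
        b0 + b1 * y + b4 * y ^ 4) := by
  obtain ⟨u, v, w, hvd, hv0, hv, hF⟩ := uvw hq hq0 hz
  have n5 := F_ne_zero (norm_pow_lt_one hq (n := 5) (by norm_num))
  have hz5 : z ^ 5 = 1 := hz.pow_eq_one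
  have hyk : ∀ k : ℕ, (z ^ k) ^ 5 = 1 := fun k => by
    rw [← pow_mul, mul_comm, pow_mul, hz5, one_pow]
  have hP : 1 + z + z ^ 2 + z ^ 3 + z ^ 4 = 0 := by
    have := hz.geom_sum_eq_zero (by norm_num)
    simpa [Finset.sum_range_succ] using this
  have hN := F_norm hq hz
  rw [Finset.prod_congr rfl fun k _ => hF (z ^ k) (hyk k)] at hN
  simp only [Finset.prod_range_succ, Finset.prod_range_zero, pow_zero, one_mul, pow_one,
    one_pow] at hN
  rw [norm_poly hP hv] at hN
  have hE : ∀ y : ℂ, y ^ 5 = 1 → y * q * qpoch (q ^ 5) (q ^ 5) ^ 5 / qpoch (y * q) (y * q) =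
      y * v * quart u (y * v) (y ^ 2 * w) / qpoch (q ^ 5) (q ^ 5) := by
    intro y hy
    have hyn : ‖y‖ = 1 := Complex.norm_eq_one_of_pow_eq_one hy (by norm_num)
    have hyq : ‖y * q‖ < 1 := by rw [norm_mul, hyn, one_mul]; exact hq
    have ny := F_ne_zero hyq
    rw [div_eq_div_iff ny n5, hF y hy]
    have hm := quart_mul hy hv
    rw [← hm] at hN
    rw [hvd] at hN ⊢
    linear_combination (-y * q) * hN
  generalize qpoch (q ^ 5) (q ^ 5) = f at *
  refine ⟨(-w ^ 5 + 14 * u ^ 2 * v * w ^ 2 + u ^ 5) / f, (20 * u * v * w ^ 3 + 10 * u ^ 4 * w) / f,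
    (-10 * u * w ^ 4 + 20 * u ^ 3 * v * w) / f, (-w ^ 5 - 36 * u ^ 2 * v * w ^ 2 + u ^ 5) / f,
    (30 * u ^ 2 * w ^ 3 - 10 * u ^ 4 * v) / f, (-10 * v * w ^ 4 - 30 * u ^ 3 * w ^ 2) / f, ?_⟩
  intro y hy
  rw [hE y hy, hF y hy]
  unfold quart
  constructor
  · field_simp
    linear_combination (15 * y ^ 2 * u ^ 3 + 20 * y ^ 4 * u * v ^ 2 - 10 * y ^ 4 * u ^ 2 * w +
      24 * y ^ 5 * v ^ 3 + 44 * y ^ 5 * u * v * w - 20 * y ^ 6 * v ^ 2 * w + 10 * y ^ 6 * u * w ^ 2 -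
      15 * y ^ 8 * w ^ 3) * hv + (-w ^ 5 + 14 * u ^ 2 * v * w ^ 2 + 20 * y ^ 2 * u * v * w ^ 3 -
      10 * y ^ 3 * u * w ^ 4 - y ^ 5 * w ^ 5) * hy
  · field_simp
    linear_combination (5 * y ^ 2 * u ^ 3 - 20 * y ^ 3 * u ^ 2 * v - 10 * y ^ 4 * u * v ^ 2 -
      40 * y ^ 4 * u ^ 2 * w - 26 * y ^ 5 * v ^ 3 - 6 * y ^ 5 * u * v * w + 10 * y ^ 6 * v ^ 2 * w +
      40 * y ^ 6 * u * w ^ 2 - 20 * y ^ 7 * v * w ^ 2 - 5 * y ^ 8 * w ^ 3) * hv +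
      (-w ^ 5 - 36 * u ^ 2 * v * w ^ 2 + 30 * y * u ^ 2 * w ^ 3 - 10 * y ^ 4 * v * w ^ 4 -
      y ^ 5 * w ^ 5) * hy

lemma psiNeg_neg {q : ℂ} (hq : ‖q‖ < 1) :
    psiNeg (-q) = qpoch (q ^ 2) (q ^ 2) ^ 2 / qpoch q q := by
  have hq2 : ‖q ^ 2‖ < 1 := norm_pow_lt_one hq two_ne_zero
  have n1 := F_ne_zero hq
  have n2 := F_ne_zero hq2
  have o1 := odd_poch hq
  have o2 := odd_poch (q := -q) (by rwa [norm_neg])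
  have o3 := odd_poch hq2
  have e4 : (q ^ 2) ^ 2 = q ^ 4 := by ring
  have m : qpoch q (q ^ 2) * qpoch (-q) (q ^ 2) = qpoch (q ^ 2) (q ^ 4) := by
    have h1 := qpoch_mul_neg q hq2
    rw [e4] at h1
    exact h1
  have e2 : (-q) ^ 2 = q ^ 2 := by ring
  have e44 : (-q) ^ 4 = q ^ 4 := by ring
  rw [e2] at o2
  rw [e4] at o3
  unfold psiNeg
  rw [e2, e44, div_eq_div_iff n2 n1, ← o1, ← o2]
  rw [← m] at o3
  linear_combination qpoch (q ^ 2) (q ^ 2) ^ 2 * o3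

lemma T_diss {q z : ℂ} (hq : ‖q‖ < 1) (hq0 : q ≠ 0) (hz : IsPrimitiveRoot z 5) :
    ∃ c0 c2 c3 : ℂ, ∀ y : ℂ, y ^ 5 = 1 →
      (y * q) ^ 3 * (psiNeg ((-(y * q)) ^ 5) ^ 5 / psiNeg (-(y * q))) +
      (y * q) ^ 2 * (qpoch (((y * q) ^ 2) ^ 5) (((y * q) ^ 2) ^ 5) ^ 5 /
        qpoch ((y * q) ^ 2) ((y * q) ^ 2)) = c0 + c2 * y ^ 2 + c3 * y ^ 3 := by
  obtain ⟨a0, a2, a3, _, _, _, hA⟩ := KE_diss hq hq0 hz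
  obtain ⟨_, _, _, b0, b1, b4, hB⟩ := KE_diss (norm_pow_lt_one hq two_ne_zero)
    (pow_ne_zero 2 hq0) hz
  refine ⟨(a0 - b0) / 20, (a2 - b1) / 20, (a3 - b4) / 20, fun y hy => ?_⟩
  have hyn : ‖y‖ = 1 := Complex.norm_eq_one_of_pow_eq_one hy (by norm_num)
  have hyq : ‖y * q‖ < 1 := by rw [norm_mul, hyn, one_mul]; exact hq
  have hy0 : y ≠ 0 := by rintro rfl; simp at hyn
  have hyq0 : y * q ≠ 0 := mul_ne_zero hy0 hq0
  have hA1 := (hA y hy).1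
  have hB1 := (hB (y ^ 2) (by rw [← pow_mul, mul_comm, pow_mul, hy, one_pow])).2
  have ks := key_star hyq hyq0
  have e1 : q ^ 5 = (y * q) ^ 5 := by rw [mul_pow, hy, one_mul]
  have e2 : y ^ 2 * q ^ 2 = (y * q) ^ 2 := by ring
  have e3 : (q ^ 2) ^ 5 = (y * q) ^ 10 := by
    have : (q ^ 2) ^ 5 = (q ^ 5) ^ 2 := by ring
    rw [this, e1]; ring
  have e4 : (-(y * q)) ^ 5 = -(y * q) ^ 5 := by ring
  have e5 : ((y * q) ^ 5) ^ 2 = (y * q) ^ 10 := by ring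
  have e6 : ((y * q) ^ 2) ^ 5 = (y * q) ^ 10 := by ring
  rw [e1] at hA1
  rw [e2, e3] at hB1
  rw [e4, psiNeg_neg hyq, psiNeg_neg (norm_pow_lt_one hyq (by norm_num)), e5, e6]
  have n1 := F_ne_zero hyq
  have n2 := F_ne_zero (norm_pow_lt_one hyq (n := 2) (by norm_num))
  have n5 := F_ne_zero (norm_pow_lt_one hyq (n := 5) (by norm_num))
  have e7 : (qpoch ((y * q) ^ 10) ((y * q) ^ 10) ^ 2 / qpoch ((y * q) ^ 5) ((y * q) ^ 5)) ^ 5 /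
      (qpoch ((y * q) ^ 2) ((y * q) ^ 2) ^ 2 / qpoch (y * q) (y * q)) =
      qpoch ((y * q) ^ 10) ((y * q) ^ 10) ^ 10 * qpoch (y * q) (y * q) /
      (qpoch ((y * q) ^ 5) ((y * q) ^ 5) ^ 5 * qpoch ((y * q) ^ 2) ((y * q) ^ 2) ^ 2) := by
    generalize qpoch (y * q) (y * q) = f1 at *
    generalize qpoch ((y * q) ^ 2) ((y * q) ^ 2) = f2 at *
    generalize qpoch ((y * q) ^ 5) ((y * q) ^ 5) = f5 at *
    generalize qpoch ((y * q) ^ 10) ((y * q) ^ 10) = f10 at *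
    field_simp
  rw [e7]
  have y8 : (y ^ 2) ^ 4 = y ^ 3 := by linear_combination y ^ 3 * hy
  rw [y8] at hB1
  linear_combination ks / 20 + hA1 / 20 - hB1 / 20

lemma hasSum_of_eq {f g : ℕ → ℂ} {a : ℂ} (h : ∀ n, f n = g n) (hg : HasSum g a) : HasSum f a := by
  rw [funext h]; exact hg

lemma pow_series_zero {h : ℕ → ℂ} (hs : ∀ q : ℂ, ‖q‖ < 1 → HasSum (fun n => h n * q ^ n) 0) (n : ℕ) :
    h n = 0 := by
  have hp : HasFPowerSeriesAt (0 : ℂ → ℂ) (FormalMultilinearSeries.ofScalars ℂ h) 0 := by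
    rw [hasFPowerSeriesAt_iff]
    filter_upwards [Metric.ball_mem_nhds (0 : ℂ) one_pos] with x hx
    have := hs x (by simpa using hx)
    simpa [FormalMultilinearSeries.coeff_ofScalars, mul_comm] using this
  have h0 := hp.eq_zero
  have : (FormalMultilinearSeries.ofScalars ℂ h).coeff n = 0 := by rw [h0]; rfl
  simpa [FormalMultilinearSeries.coeff_ofScalars] using this

/-- Coefficients of the combined series. -/
noncomputable def tco (c b : ℕ → ℤ) (N : ℕ) : ℂ :=
  (if 3 ≤ N then (-1) ^ (N - 3) * (b (N - 3) : ℂ) else 0) +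
  (if 2 ≤ N ∧ N % 2 = 0 then (c ((N - 2) / 2) : ℂ) else 0)

lemma tco_hasSum {c b : ℕ → ℤ} {q B C : ℂ}
    (hb : HasSum (fun n : ℕ => (b n : ℂ) * (-q) ^ n) B)
    (hc : HasSum (fun n : ℕ => (c n : ℂ) * (q ^ 2) ^ n) C) :
    HasSum (fun N => tco c b N * q ^ N) (q ^ 3 * B + q ^ 2 * C) := by
  have h1 : HasSum (fun N => (if 3 ≤ N then (-1) ^ (N - 3) * (b (N - 3) : ℂ) else 0) * q ^ N)
      (q ^ 3 * B) := by
    have hi : Function.Injective (fun n : ℕ => n + 3) := fun a b h => by simpa using h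
    rw [← hi.hasSum_iff]
    · refine hasSum_of_eq (fun n => ?_) (hb.mul_left (q ^ 3))
      simp only [Function.comp, Nat.add_sub_cancel, le_add_iff_nonneg_left, zero_le, if_true]
      rw [neg_pow q n]; ring
    · intro x hx
      have : ¬ 3 ≤ x := fun h => hx ⟨x - 3, by simp only; omega⟩
      simp [this]
  have h2 : HasSum (fun N => (if 2 ≤ N ∧ N % 2 = 0 then (c ((N - 2) / 2) : ℂ) else 0) * q ^ N)
      (q ^ 2 * C) := by
    have hi : Function.Injective (fun n : ℕ => 2 * n + 2) := fun a b h => by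
      simp only at h; omega
    rw [← hi.hasSum_iff]
    · refine hasSum_of_eq (fun n => ?_) (hc.mul_left (q ^ 2))
      have e1 : 2 ≤ 2 * n + 2 ∧ (2 * n + 2) % 2 = 0 := by omega
      have e2 : (2 * n + 2 - 2) / 2 = n := by omega
      simp only [Function.comp, e1, e2, and_self, if_true]
      ring
    · intro x hx
      have : ¬ (2 ≤ x ∧ x % 2 = 0) := fun h => hx ⟨(x - 2) / 2, by simp only; omega⟩
      simp [this]
  convert h1.add h2 using 2 with N
  unfold tco; ring

lemma summable_of_tsum_ne {f : ℕ → ℂ} {a : ℂ} (h : ∑' n, f n = a) (ha : a ≠ 0) : HasSum f a := by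
  have hs : Summable f := by
    by_contra hn
    rw [tsum_eq_zero_of_not_summable hn] at h
    exact ha h.symm
  rw [← h]; exact hs.hasSum

lemma psiNeg_ne_zero {q : ℂ} (hq : ‖q‖ < 1) : psiNeg q ≠ 0 := by
  unfold psiNeg
  exact div_ne_zero (mul_ne_zero (F_ne_zero hq) (F_ne_zero (norm_pow_lt_one hq (by norm_num))))
    (F_ne_zero (norm_pow_lt_one hq (by norm_num)))

lemma tco_eq_zero {c b : ℕ → ℤ}
    (hc : ∀ q : ℂ, ‖q‖ < 1 →
      ∑' n : ℕ, (c n : ℂ) * q ^ n = qpoch (q ^ 5) (q ^ 5) ^ 5 / qpoch q q)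
    (hb : ∀ q : ℂ, ‖q‖ < 1 →
      ∑' n : ℕ, (b n : ℂ) * q ^ n = psiNeg (q ^ 5) ^ 5 / psiNeg q)
    (m N : ℕ) (hm : m = 1 ∨ m = 4) (hN : (N + m) % 5 = 0) : tco c b N = 0 := by
  have hz : IsPrimitiveRoot (Complex.exp (2 * Real.pi * Complex.I / (5 : ℕ))) 5 :=
    Complex.isPrimitiveRoot_exp 5 (by norm_num)
  generalize Complex.exp (2 * Real.pi * Complex.I / (5 : ℕ)) = z at hz
  have hz5 : z ^ 5 = 1 := hz.pow_eq_one
  have hyk : ∀ k : ℕ, (z ^ k) ^ 5 = 1 := fun k => by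
    rw [← pow_mul, mul_comm, pow_mul, hz5, one_pow]
  have hP : 1 + z + z ^ 2 + z ^ 3 + z ^ 4 = 0 := by
    have := hz.geom_sum_eq_zero (by norm_num)
    simpa [Finset.sum_range_succ] using this
  have key : ∀ q : ℂ, ‖q‖ < 1 → HasSum
      (fun n => (tco c b n * ∑ k ∈ Finset.range 5, (z ^ (n + m)) ^ k) * q ^ n) 0 := by
    intro q hq
    rcases eq_or_ne q 0 with rfl | hq0
    · convert hasSum_zero with n
      rcases n with _ | n
      · simp [tco]
      · simp
    obtain ⟨c0, c2, c3, hT⟩ := T_diss hq hq0 hz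
    have hk : ∀ k ∈ Finset.range 5, HasSum (fun n => (z ^ k) ^ m * (tco c b n * (z ^ k * q) ^ n))
        ((z ^ k) ^ m * (c0 + c2 * (z ^ k) ^ 2 + c3 * (z ^ k) ^ 3)) := by
      intro k _
      rw [← hT (z ^ k) (hyk k)]
      have hyn : ‖z ^ k‖ = 1 := Complex.norm_eq_one_of_pow_eq_one (hyk k) (by norm_num)
      have hyq : ‖z ^ k * q‖ < 1 := by rw [norm_mul, hyn, one_mul]; exact hq
      have hyq' : ‖-(z ^ k * q)‖ < 1 := by rwa [norm_neg]
      have hyq2 : ‖(z ^ k * q) ^ 2‖ < 1 := norm_pow_lt_one hyq two_ne_zero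
      refine HasSum.mul_left _ (tco_hasSum ?_ ?_)
      · exact summable_of_tsum_ne (hb _ hyq') (div_ne_zero (pow_ne_zero _ (psiNeg_ne_zero
          (norm_pow_lt_one hyq' (by norm_num)))) (psiNeg_ne_zero hyq'))
      · exact summable_of_tsum_ne (hc _ hyq2) (div_ne_zero (pow_ne_zero _ (F_ne_zero
          (norm_pow_lt_one hyq2 (by norm_num)))) (F_ne_zero hyq2))
    convert hasSum_sum hk using 1
    · funext n
      rw [Finset.mul_sum, Finset.sum_mul]
      refine Finset.sum_congr rfl fun k _ => ?_
      rw [mul_pow, ← pow_mul, ← pow_mul, ← pow_mul, add_mul, pow_add, mul_comm k m, mul_comm k n]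
      ring
    · simp only [Finset.sum_range_succ, Finset.sum_range_zero]
      rcases hm with rfl | rfl
      · linear_combination (-c0 +
          c2 * (-1 + z - z ^ 3 + z ^ 4 - z ^ 5 + z ^ 7 - z ^ 8) +
          c3 * (-1 + z - z ^ 4 + z ^ 6 - z ^ 8 + z ^ 11 - z ^ 12)) * hP
      · linear_combination (c0 * (-1 + z - z ^ 4 + z ^ 6 - z ^ 8 + z ^ 11 - z ^ 12) +
          c2 * (-1 + z - z ^ 5 + z ^ 7 - z ^ 10 + z ^ 13 - z ^ 15 + z ^ 19 - z ^ 20) +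
          c3 * (-1 + z - z ^ 5 + z ^ 6 - z ^ 7 + z ^ 8 - z ^ 10 + z ^ 11 - z ^ 12 + z ^ 13 -
            z ^ 14 + z ^ 16 - z ^ 17 + z ^ 18 - z ^ 19 + z ^ 23 - z ^ 24)) * hP
  have h0 := pow_series_zero key N
  obtain ⟨j, hj⟩ := Nat.dvd_of_mod_eq_zero hN
  have hs : ∑ k ∈ Finset.range 5, (z ^ (N + m)) ^ k = 5 := by
    rw [hj, pow_mul, hz5]; simp
  rw [hs] at h0
  simpa using h0

theorem stmt_14 (c b : ℕ → ℤ)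
    (hc : ∀ q : ℂ, ‖q‖ < 1 →
      ∑' n : ℕ, (c n : ℂ) * q ^ n = qpoch (q ^ 5) (q ^ 5) ^ 5 / qpoch q q)
    (hb : ∀ q : ℂ, ‖q‖ < 1 →
      ∑' n : ℕ, (b n : ℂ) * q ^ n = psiNeg (q ^ 5) ^ 5 / psiNeg q) :
    ∀ n : ℕ, b (10 * n + 1) = c (5 * n + 1) ∧ b (10 * n + 3) = c (5 * n + 2) := by
  intro n
  have h1 := tco_eq_zero hc hb 1 (10 * n + 4) (Or.inl rfl) (by omega)
  have h2 := tco_eq_zero hc hb 4 (10 * n + 6) (Or.inr rfl) (by omega)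
  unfold tco at h1 h2
  have a1 : 3 ≤ 10 * n + 4 := by omega
  have a2 : 2 ≤ 10 * n + 4 ∧ (10 * n + 4) % 2 = 0 := by omega
  have a3 : 10 * n + 4 - 3 = 10 * n + 1 := by omega
  have a4 : (10 * n + 4 - 2) / 2 = 5 * n + 1 := by omega
  have b1 : 3 ≤ 10 * n + 6 := by omega
  have b2 : 2 ≤ 10 * n + 6 ∧ (10 * n + 6) % 2 = 0 := by omega
  have b3 : 10 * n + 6 - 3 = 10 * n + 3 := by omega
  have b4 : (10 * n + 6 - 2) / 2 = 5 * n + 2 := by omega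
  have o1 : (-1 : ℂ) ^ (10 * n + 1) = -1 := Odd.neg_one_pow ⟨5 * n, by ring⟩
  have o2 : (-1 : ℂ) ^ (10 * n + 3) = -1 := Odd.neg_one_pow ⟨5 * n + 1, by ring⟩
  rw [if_pos a1, if_pos a2, a3, a4, o1] at h1
  rw [if_pos b1, if_pos b2, b3, b4, o2] at h2
  constructor
  · have : (b (10 * n + 1) : ℂ) = c (5 * n + 1) := by linear_combination -h1
    exact_mod_cast this
  · have : (b (10 * n + 3) : ℂ) = c (5 * n + 2) := by linear_combination -h2
    exact_mod_cast this
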